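/- arXiv:1907.04750 — 6 statements merged into one kernel-verified Lean document; each statement's English description precedes it below -/
import Mathlib

section
/- For every ε ∈ (0,1) there exists a constant C > 0 such that for all sufficiently large n the following holds: with m = ⌈(1−ε)n⌉ and L = ⌈C·(log n)/ε⌉, the m rows of the random block matrix A are linearly independent over 𝔽₂ (that is, A has full row rank m) with probability at least 1 − C/m. -/
/-- The row of the random block matrix determined by the pair
`(s, p)` of a starting position `s ∈ {0, …, n-1}` and a block `p` of `L` field
elements: entry `j` equals `p (j - s)` for `s ≤ j < s + L` and `0` otherwise. -/
def blockRow (F : Type) [Zero F] (n L : ℕ) (r : Fin n × (Fin L → F)) :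
    Fin (n + L - 1) → F := fun j =>
  if h : r.1.val ≤ j.val ∧ j.val < r.1.val + L then r.2 ⟨j.val - r.1.val, by omega⟩ else 0

/-- The rows with start positions `s i`, `i ∈ S`, start between `a` and `e`, and their blocks
of length `L` cover the columns `a, …, e + L - 1`. -/
def BlocksCover {m n : ℕ} (L : ℕ) (s : Fin m → Fin n) (S : Finset (Fin m)) (a e : Fin n) : Prop :=
  (∀ i ∈ S, a ≤ s i ∧ s i ≤ e) ∧
    ∀ j : ℕ, a.val ≤ j → j < e.val + L → ∃ i ∈ S, (s i).val ≤ j ∧ j < (s i).val + L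

lemma blockRow_eq_zero {F : Type} [Zero F] {n L : ℕ} (r : Fin n × (Fin L → F))
    (j : Fin (n + L - 1)) (h : ¬(r.1.val ≤ j.val ∧ j.val < r.1.val + L)) :
    blockRow F n L r j = 0 := dif_neg h

lemma blockRow_add {F : Type} [AddZeroClass F] {n L : ℕ} (s : Fin n) (p q : Fin L → F)
    (j : Fin (n + L - 1)) :
    blockRow F n L (s, p + q) j = blockRow F n L (s, p) j + blockRow F n L (s, q) j := by
  unfold blockRow
  split_ifs <;> simp

/-- A nonempty set of block rows with zero sum contains a subset with zero sum whose blocks cover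
an interval of columns. -/
lemma exists_blocksCover_sum_eq_zero {F : Type} [AddCommMonoid F] {m n L : ℕ} (hL : 0 < L)
    (s : Fin m → Fin n) (p : Fin m → Fin L → F) (S : Finset (Fin m)) (hS : S.Nonempty)
    (h0 : ∀ j, ∑ i ∈ S, blockRow F n L (s i, p i) j = 0) :
    ∃ a e : Fin n, a ≤ e ∧ ∃ T : Finset (Fin m), BlocksCover L s T a e ∧
      ∀ j, ∑ i ∈ T, blockRow F n L (s i, p i) j = 0 := by
  classical
  obtain ⟨i₀, hi₀, hmin⟩ := S.exists_min_image s hS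
  have hex : ∃ b : ℕ, (s i₀).val < b ∧ ∀ i ∈ S, (s i).val < b → (s i).val + L ≤ b :=
    ⟨n + L, by omega, fun i _ _ => by omega⟩
  obtain ⟨hb1, hb2⟩ := Nat.find_spec hex
  have hbmin := fun k => Nat.find_min (H := hex) (m := k)
  set b := Nat.find hex
  set T := S.filter (fun i => (s i).val < b) with hT
  have hi₀T : i₀ ∈ T := by simp [hT, hi₀, hb1]
  obtain ⟨i₁, hi₁, hmax⟩ := T.exists_max_image s ⟨i₀, hi₀T⟩
  have hTS : T ⊆ S := Finset.filter_subset _ _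
  have hTb : ∀ i ∈ T, (s i).val < b := fun i hi => (Finset.mem_filter.1 hi).2
  have hend : (s i₁).val + L ≤ b := hb2 _ (hTS hi₁) (hTb _ hi₁)
  refine ⟨s i₀, s i₁, hmin _ (hTS hi₁), T,
    ⟨fun i hi => ⟨hmin _ (hTS hi), hmax _ hi⟩, fun j hj1 hj2 => ?_⟩, fun j => ?_⟩
  · rcases hj1.eq_or_lt with h | h
    · exact ⟨i₀, hi₀T, h.le, by omega⟩
    · have := hbmin j (by omega)
      push Not at this
      obtain ⟨i, hi, h1, h2⟩ := this h
      exact ⟨i, Finset.mem_filter.2 ⟨hi, by omega⟩, h1.le, h2⟩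
  · by_cases hj : j.val < b
    · rw [← h0 j]
      refine Finset.sum_subset hTS fun i hi hiT => blockRow_eq_zero _ _ ?_
      have : ¬ (s i).val < b := fun h => hiT (Finset.mem_filter.2 ⟨hi, h⟩)
      dsimp only
      omega
    · refine Finset.sum_eq_zero fun i hi => blockRow_eq_zero _ _ ?_
      have := hb2 i (hTS hi) (hTb i hi)
      dsimp only
      omega

/-- If the blocks of the rows in `S` cover `ℓ` columns, then at most a fraction `|F|^(-ℓ)` of
the choices of the blocks makes the sum of these rows vanish. -/
lemma card_pow_mul_card_sum_eq_zero_le {F : Type} [AddCommGroup F] [Fintype F] [DecidableEq F]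
    {m n L : ℕ} (hL : 0 < L) (s : Fin m → Fin n) (S : Finset (Fin m)) (a e : Fin n)
    (hS : BlocksCover L s S a e) :
    Fintype.card F ^ (e.val + L - a.val) *
      (Finset.univ.filter (fun p : Fin m → Fin L → F =>
        ∀ j, ∑ i ∈ S, blockRow F n L (s i, p i) j = 0)).card ≤
      Fintype.card (Fin m → Fin L → F) := by
  classical
  set ℓ := e.val + L - a.val with hℓ
  have hcov : ∀ j : Fin ℓ, ∃ i ∈ S, (s i).val ≤ a.val + j.val ∧ a.val + j.val < (s i).val + L :=
    fun j => hS.2 _ (by omega) (by omega)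
  choose c hcS hc1 hc2 using hcov
  let σ : (Fin ℓ → F) → Fin m → Fin L → F := fun v i k =>
    if h : a.val ≤ (s i).val + k.val ∧ (s i).val + k.val - a.val < ℓ then
      if c ⟨(s i).val + k.val - a.val, h.2⟩ = i then v ⟨(s i).val + k.val - a.val, h.2⟩ else 0
    else 0
  have hcol : ∀ j : Fin ℓ, a.val + j.val < n + L - 1 := fun j => by omega
  have hσ : ∀ v (j : Fin ℓ), ∑ i ∈ S, blockRow F n L (s i, σ v i) ⟨a.val + j.val, hcol j⟩ = v j := by
    intro v j
    rw [Finset.sum_eq_single_of_mem (c j) (hcS j)]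
    · have h1 := hc1 j
      have h2 := hc2 j
      simp [blockRow, σ, h1, h2]
    · intro i _ hne
      by_cases h : (s i).val ≤ a.val + j.val ∧ a.val + j.val < (s i).val + L
      · have h3 : (s i).val + (a.val + j.val - (s i).val) - a.val = j.val := by omega
        simp [blockRow, σ, h3, hne.symm]
      · exact blockRow_eq_zero _ _ h
  rw [← Fintype.card_fin ℓ, ← Fintype.card_fun, ← Fintype.card_coe, ← Fintype.card_prod]
  refine Fintype.card_le_of_injective (fun x => x.2.1 + σ x.1) ?_
  rintro ⟨v, p, hp⟩ ⟨w, q, hq⟩ h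
  simp only [Finset.mem_filter, Finset.mem_univ, true_and] at hp hq
  dsimp only at h
  have hrec : ∀ (v : Fin ℓ → F) (p : Fin m → Fin L → F),
      (∀ j, ∑ i ∈ S, blockRow F n L (s i, p i) j = 0) → ∀ j : Fin ℓ,
      ∑ i ∈ S, blockRow F n L (s i, (p + σ v) i) ⟨a.val + j.val, hcol j⟩ = v j := by
    intro v p hp j
    simp only [Pi.add_apply p, blockRow_add, Finset.sum_add_distrib, hp, hσ, zero_add]
  have hvw : v = w := by
    funext j
    rw [← hrec v p hp j, ← hrec w q hq j, h]
  subst hvw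
  have hpq : p = q := add_right_cancel h
  subst hpq
  rfl

/-- Linearly dependent vectors over `𝔽₂` have a nonempty subfamily with zero sum. -/
lemma exists_sum_eq_zero_of_not_linearIndependent {ι κ : Type*} [Fintype ι]
    (v : ι → κ → ZMod 2) (h : ¬ LinearIndependent (ZMod 2) v) :
    ∃ S : Finset ι, S.Nonempty ∧ ∀ j, ∑ i ∈ S, v i j = 0 := by
  classical
  obtain ⟨g, hg, i, hi⟩ := Fintype.not_linearIndependent_iff.1 h
  refine ⟨Finset.univ.filter (fun i => g i ≠ 0), ⟨i, by simpa using hi⟩, fun j => ?_⟩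
  have hj := congrFun hg j
  simp only [Finset.sum_apply, Pi.smul_apply, smul_eq_mul, Pi.zero_apply] at hj
  refine Eq.trans ?_ hj
  rw [Finset.sum_filter]
  refine Finset.sum_congr rfl fun i _ => ?_
  have h01 : ∀ x : ZMod 2, x = 0 ∨ x = 1 := by decide
  rcases h01 (g i) with h | h <;> simp only [h] <;> simp

lemma two_pow_mul_min_le_exp {X ℓ : ℕ} {θ N T : ℝ} (hθ0 : 0 ≤ θ) (hθ : θ ≤ Real.log 2)
    (hT : 0 ≤ T) (h1 : N ≤ T) (h2 : 2 ^ ℓ * N ≤ 2 ^ X * T) :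
    N ≤ T * (Real.exp θ ^ X * Real.exp (-(θ * ℓ))) := by
  rw [← Real.exp_nat_mul, ← Real.exp_add]
  rcases le_total ℓ X with h | h
  · have h' : (ℓ : ℝ) ≤ X := by exact_mod_cast h
    have : 1 ≤ Real.exp (X * θ + -(θ * ℓ)) := Real.one_le_exp (by nlinarith)
    nlinarith
  · have h' : (X : ℝ) ≤ ℓ := by exact_mod_cast h
    have h3 : N ≤ T * Real.exp (Real.log 2 * X + -(Real.log 2 * ℓ)) := by
      rw [Real.exp_add, Real.exp_neg, Real.exp_mul, Real.exp_mul, Real.exp_log two_pos,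
        Real.rpow_natCast, Real.rpow_natCast, ← mul_assoc, ← div_eq_mul_inv,
        le_div_iff₀ (by positivity)]
      linarith
    refine h3.trans (mul_le_mul_of_nonneg_left (Real.exp_le_exp.2 ?_) hT)
    nlinarith

/-- The exponential moment of the number of random start positions in an interval. -/
lemma sum_exp_pow_card_le {m n : ℕ} (hn : 0 < n) (a e : Fin n) {θ : ℝ} (hθ : 0 ≤ θ) {ℓ : ℕ}
    (hℓ : e.val + 1 - a.val ≤ ℓ) :
    ∑ s : Fin m → Fin n, Real.exp θ ^ (Finset.univ.filter (fun i => a ≤ s i ∧ s i ≤ e)).card ≤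
      (n : ℝ) ^ m * Real.exp ((Real.exp θ - 1) * ℓ * (m / n)) := by
  have hn' : (0 : ℝ) < n := by exact_mod_cast hn
  have hE : 0 ≤ Real.exp θ - 1 := by linarith [Real.add_one_le_exp θ]
  have hrw : ∀ s : Fin m → Fin n,
      Real.exp θ ^ (Finset.univ.filter (fun i => a ≤ s i ∧ s i ≤ e)).card =
        ∏ i, (fun x => if a ≤ x ∧ x ≤ e then Real.exp θ else 1) (s i) := by
    intro s
    rw [Finset.prod_ite, Finset.prod_const, Finset.prod_const_one, mul_one]
  rw [Finset.sum_congr rfl fun s _ => hrw s,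
    ← Fintype.sum_pow (fun x => if a ≤ x ∧ x ≤ e then Real.exp θ else 1) m]
  have hsum : ∑ x : Fin n, (if a ≤ x ∧ x ≤ e then Real.exp θ else 1) ≤
      n * Real.exp ((Real.exp θ - 1) * ℓ / n) := by
    have h1 : ∀ x : Fin n, (if a ≤ x ∧ x ≤ e then Real.exp θ else 1) =
        1 + if x ∈ Finset.Icc a e then Real.exp θ - 1 else 0 := by
      intro x
      simp only [Finset.mem_Icc]
      split_ifs <;> ring
    simp_rw [h1]
    rw [Finset.sum_add_distrib, Finset.sum_ite_mem, Finset.univ_inter, Finset.sum_const,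
      Finset.sum_const, Fin.card_Icc, Finset.card_univ, Fintype.card_fin, nsmul_eq_mul,
      nsmul_eq_mul, mul_one]
    have h2 : ((e.val + 1 - a.val : ℕ) : ℝ) ≤ ℓ := by exact_mod_cast hℓ
    calc (n : ℝ) + ((e.val + 1 - a.val : ℕ) : ℝ) * (Real.exp θ - 1)
        ≤ n + ℓ * (Real.exp θ - 1) := by gcongr
      _ = n * ((Real.exp θ - 1) * ℓ / n + 1) := by field_simp; ring
      _ ≤ _ := by gcongr; exact Real.add_one_le_exp _
  calc (∑ x : Fin n, (if a ≤ x ∧ x ≤ e then Real.exp θ else 1)) ^ m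
      ≤ (n * Real.exp ((Real.exp θ - 1) * ℓ / n)) ^ m := by
        refine pow_le_pow_left₀ (Finset.sum_nonneg fun x _ => ?_) hsum m
        split_ifs <;> positivity
    _ = _ := by
        rw [mul_pow, ← Real.exp_nat_mul]
        congr 2
        ring

open Classical in
/-- For fixed start positions, the number of blocks for which some set of rows covering the
columns from `a` to `e + L - 1` has zero sum. -/
lemma card_exists_blocksCover_le {m n L : ℕ} (hL : 0 < L) (s : Fin m → Fin n) (a e : Fin n)
    {θ : ℝ} (hθ0 : 0 ≤ θ) (hθ : θ ≤ Real.log 2) :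
    ((Finset.univ.filter (fun p : Fin m → Fin L → ZMod 2 => ∃ S, BlocksCover L s S a e ∧
      ∀ j, ∑ i ∈ S, blockRow (ZMod 2) n L (s i, p i) j = 0)).card : ℝ) ≤
    (Fintype.card (Fin m → Fin L → ZMod 2) : ℝ) *
      (Real.exp θ ^ (Finset.univ.filter (fun i => a ≤ s i ∧ s i ≤ e)).card *
        Real.exp (-(θ * (e.val + L - a.val : ℕ)))) := by
  refine two_pow_mul_min_le_exp hθ0 hθ (Nat.cast_nonneg _)
    (by exact_mod_cast Finset.card_le_univ _) ?_
  set W := Finset.univ.filter (fun i => a ≤ s i ∧ s i ≤ e) with hW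
  set K : Finset (Fin m) → Finset (Fin m → Fin L → ZMod 2) := fun S =>
    Finset.univ.filter (fun p => ∀ j, ∑ i ∈ S, blockRow (ZMod 2) n L (s i, p i) j = 0) with hK
  set G := W.powerset.filter (fun S => BlocksCover L s S a e)
  have hsub : (Finset.univ.filter (fun p : Fin m → Fin L → ZMod 2 => ∃ S, BlocksCover L s S a e ∧
      ∀ j, ∑ i ∈ S, blockRow (ZMod 2) n L (s i, p i) j = 0)) ⊆ G.biUnion K := by
    intro p hp
    obtain ⟨S, hS, h0⟩ := (Finset.mem_filter.1 hp).2
    refine Finset.mem_biUnion.2 ⟨S, Finset.mem_filter.2 ⟨Finset.mem_powerset.2 fun i hi => ?_, hS⟩,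
      Finset.mem_filter.2 ⟨Finset.mem_univ _, h0⟩⟩
    exact Finset.mem_filter.2 ⟨Finset.mem_univ _, hS.1 i hi⟩
  have hcard : ∀ S ∈ G, 2 ^ (e.val + L - a.val) * (K S).card ≤
      Fintype.card (Fin m → Fin L → ZMod 2) := by
    intro S hS
    have := card_pow_mul_card_sum_eq_zero_le (F := ZMod 2) hL s S a e (Finset.mem_filter.1 hS).2
    rw [ZMod.card] at this
    convert this
  have hGcard : G.card ≤ 2 ^ W.card :=
    (Finset.card_filter_le _ _).trans (Finset.card_powerset W).le
  have key := calc
    2 ^ (e.val + L - a.val) * (Finset.univ.filter (fun p : Fin m → Fin L → ZMod 2 =>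
        ∃ S, BlocksCover L s S a e ∧
          ∀ j, ∑ i ∈ S, blockRow (ZMod 2) n L (s i, p i) j = 0)).card
      ≤ 2 ^ (e.val + L - a.val) * ∑ S ∈ G, (K S).card := by
        gcongr
        exact (Finset.card_le_card hsub).trans Finset.card_biUnion_le
    _ = ∑ S ∈ G, 2 ^ (e.val + L - a.val) * (K S).card := Finset.mul_sum _ _ _
    _ ≤ G.card • Fintype.card (Fin m → Fin L → ZMod 2) := Finset.sum_le_card_nsmul _ _ _ hcard
    _ ≤ 2 ^ W.card * Fintype.card (Fin m → Fin L → ZMod 2) := by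
        rw [smul_eq_mul]
        gcongr
  exact_mod_cast key

open Classical in
/-- The number of random block matrices over `𝔽₂` with linearly dependent rows. -/
lemma card_not_linearIndependent_blockRow_le {m n L : ℕ} (hn : 0 < n) (hL : 0 < L) {θ c : ℝ}
    (hθ0 : 0 ≤ θ) (hθ : θ ≤ Real.log 2) (hc0 : 0 ≤ c)
    (hc : (Real.exp θ - 1) * (m / n) - θ ≤ -c) :
    ((Finset.univ.filter (fun ω : Fin m → Fin n × (Fin L → ZMod 2) =>
        ¬ LinearIndependent (ZMod 2) (fun i => blockRow (ZMod 2) n L (ω i)))).card : ℝ) ≤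
      (n : ℝ) ^ 2 * Real.exp (-(c * L)) *
        Fintype.card (Fin m → Fin n × (Fin L → ZMod 2)) := by
  set P : ℝ := (Fintype.card (Fin m → Fin L → ZMod 2) : ℝ) with hP
  set B : Fin n × Fin n → (Fin m → Fin n) → Finset (Fin m → Fin L → ZMod 2) := fun x s =>
    Finset.univ.filter (fun p => ∃ S, BlocksCover L s S x.1 x.2 ∧
      ∀ j, ∑ i ∈ S, blockRow (ZMod 2) n L (s i, p i) j = 0) with hB
  set Q : Finset (Fin n × Fin n) := Finset.univ.filter (fun x => x.1 ≤ x.2) with hQ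
  have hbad : (Finset.univ.filter (fun ω : Fin m → Fin n × (Fin L → ZMod 2) =>
      ¬ LinearIndependent (ZMod 2) (fun i => blockRow (ZMod 2) n L (ω i)))).card ≤
      ∑ x ∈ Q, ∑ s, (B x s).card := by
    calc _ ≤ (Q.biUnion fun x => Finset.univ.sigma (B x)).card := by
          refine Finset.card_le_card_of_injOn
            (fun ω => ⟨fun i => (ω i).1, fun i => (ω i).2⟩) ?_ ?_
          · intro ω hω
            have hω' := (Finset.mem_filter.1 hω).2
            obtain ⟨S, hS, h0⟩ := exists_sum_eq_zero_of_not_linearIndependent _ hω'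
            obtain ⟨a, e, hae, T, hT, hT0⟩ := exists_blocksCover_sum_eq_zero hL
              (fun i => (ω i).1) (fun i => (ω i).2) S hS h0
            simp only [Finset.coe_biUnion, Set.mem_iUnion]
            refine ⟨(a, e), by simp [hQ, hae], ?_⟩
            simp only [Finset.mem_coe, Finset.mem_sigma, Finset.mem_univ, true_and, hB,
              Finset.mem_filter]
            exact ⟨T, hT, hT0⟩
          · intro ω _ ω' _ h
            simp only [Sigma.mk.injEq, heq_eq_eq] at h
            funext i
            exact Prod.ext (congrFun h.1 i) (congrFun h.2 i)
      _ ≤ _ := by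
          refine Finset.card_biUnion_le.trans (Finset.sum_le_sum fun x _ => ?_)
          rw [Finset.card_sigma]
  have hpair : ∀ x ∈ Q, ∑ s, ((B x s).card : ℝ) ≤ (n : ℝ) ^ m * P * Real.exp (-(c * L)) := by
    rintro ⟨a, e⟩ hx
    have hae : a.val ≤ e.val := (Finset.mem_filter.1 hx).2
    set ℓ := e.val + L - a.val with hℓ
    have hLℓ : (L : ℝ) ≤ ℓ := by exact_mod_cast (by omega : L ≤ ℓ)
    calc ∑ s, ((B (a, e) s).card : ℝ)
        ≤ ∑ s : Fin m → Fin n, P *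
          (Real.exp θ ^ (Finset.univ.filter (fun i => a ≤ s i ∧ s i ≤ e)).card *
            Real.exp (-(θ * ℓ))) :=
          Finset.sum_le_sum fun s _ => card_exists_blocksCover_le hL s a e hθ0 hθ
      _ = P * ((∑ s : Fin m → Fin n,
          Real.exp θ ^ (Finset.univ.filter (fun i => a ≤ s i ∧ s i ≤ e)).card) *
            Real.exp (-(θ * ℓ))) := by
          rw [Finset.sum_mul, Finset.mul_sum]
      _ ≤ P * (((n : ℝ) ^ m * Real.exp ((Real.exp θ - 1) * ℓ * (m / n))) *
            Real.exp (-(θ * ℓ))) := by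
          gcongr
          exact sum_exp_pow_card_le hn a e hθ0 (by omega)
      _ = (n : ℝ) ^ m * P * Real.exp (((Real.exp θ - 1) * (m / n) - θ) * ℓ) := by
          rw [mul_assoc ((n : ℝ) ^ m), ← Real.exp_add]
          ring_nf
      _ ≤ (n : ℝ) ^ m * P * Real.exp (-(c * L)) := by
          gcongr
          nlinarith
  have htot : (Fintype.card (Fin m → Fin n × (Fin L → ZMod 2)) : ℝ) = (n : ℝ) ^ m * P := by
    simp [hP, mul_pow]
  have hQcard : (Q.card : ℝ) ≤ (n : ℝ) ^ 2 := by
    have : Q.card ≤ n ^ 2 := (Finset.card_filter_le _ _).trans (by simp [sq])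
    exact_mod_cast this
  calc _ ≤ ∑ x ∈ Q, ∑ s, ((B x s).card : ℝ) := by exact_mod_cast hbad
    _ ≤ Q.card • ((n : ℝ) ^ m * P * Real.exp (-(c * L))) := Finset.sum_le_card_nsmul _ _ _ hpair
    _ ≤ (n : ℝ) ^ 2 * ((n : ℝ) ^ m * P * Real.exp (-(c * L))) := by
        rw [nsmul_eq_mul]
        gcongr
    _ = _ := by rw [htot]; ring

open Classical in
/-- For every `ε ∈ (0,1)` there is a constant `C > 0` such that for all sufficiently
large `n`, with `m = ⌈(1-ε)n⌉` and `L = ⌈C (log n)/ε⌉`, the `m` rows of the random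
block matrix (one uniformly random starting position in `{1,…,n}` and one uniformly
random block of `L` bits per row, all rows independent) are linearly independent
over `𝔽₂` with probability at least `1 - C/m`. -/
theorem fullRowRank_of_randomBlockMatrix (ε : ℝ) (hε0 : 0 < ε) (hε1 : ε < 1) :
    ∃ C : ℝ, 0 < C ∧ ∃ N : ℕ, ∀ n : ℕ, N ≤ n →
      (1 : ℝ) - C / (⌈(1 - ε) * (n : ℝ)⌉₊ : ℝ) ≤
        ((Finset.univ.filter
            (fun ω : Fin ⌈(1 - ε) * (n : ℝ)⌉₊ →
                Fin n × (Fin ⌈C * Real.log n / ε⌉₊ → ZMod 2) =>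
              LinearIndependent (ZMod 2)
                (fun i => blockRow (ZMod 2) n ⌈C * Real.log n / ε⌉₊ (ω i)))).card : ℝ) /
        (Fintype.card (Fin ⌈(1 - ε) * (n : ℝ)⌉₊ →
            Fin n × (Fin ⌈C * Real.log n / ε⌉₊ → ZMod 2)) : ℝ) := by
  refine ⟨48 / ε, by positivity, ⌈2 / ε⌉₊ + 2, fun n hn => ?_⟩
  set m := ⌈(1 - ε) * (n : ℝ)⌉₊
  set L := ⌈48 / ε * Real.log n / ε⌉₊
  have hn2 : (2 : ℝ) ≤ n := by exact_mod_cast (by omega : 2 ≤ n)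
  have hn0 : (0 : ℝ) < n := by linarith
  have hlog : 0 < Real.log n := Real.log_pos (by linarith)
  have hnε : 2 ≤ ε * n := by
    have h1 : 2 / ε ≤ n := (Nat.le_ceil _).trans (by exact_mod_cast (by omega : ⌈2 / ε⌉₊ ≤ n))
    rwa [div_le_iff₀' hε0] at h1
  have hL0 : 0 < L := Nat.ceil_pos.2 (by positivity)
  have hLle : 48 / ε * Real.log n / ε ≤ L := Nat.le_ceil _
  have hm0 : (0 : ℝ) < m := by
    have : 0 < m := Nat.ceil_pos.2 (mul_pos (by linarith) hn0)
    exact_mod_cast this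
  have hmn : (m : ℝ) ≤ (1 - ε / 2) * n := by
    have := Nat.ceil_lt_add_one (mul_nonneg (by linarith : 0 ≤ 1 - ε) hn0.le)
    nlinarith
  have hmdiv : (m : ℝ) / n ≤ 1 - ε / 2 := by rwa [div_le_iff₀ hn0]
  have hrate : (Real.exp (ε / 4) - 1) * (m / n) - ε / 4 ≤ -(ε ^ 2 / 16) := by
    have h1 : Real.exp (ε / 4) - 1 ≤ ε / 4 + (ε / 4) ^ 2 := by
      have := (abs_le.1 (Real.abs_exp_sub_one_sub_id_le (x := ε / 4)
        (by rw [abs_of_pos (by positivity)]; linarith))).2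
      linarith
    calc (Real.exp (ε / 4) - 1) * (m / n) - ε / 4
        ≤ (ε / 4 + (ε / 4) ^ 2) * (1 - ε / 2) - ε / 4 := by gcongr
      _ ≤ _ := by nlinarith [pow_pos hε0 3]
  have hbad := card_not_linearIndependent_blockRow_le (m := m) (n := n) (by omega) hL0
    (by positivity : 0 ≤ ε / 4) (by linarith [Real.log_two_gt_d9]) (by positivity) hrate
  have hexp : (n : ℝ) ^ 2 * Real.exp (-(ε ^ 2 / 16 * L)) ≤ 48 / ε / m := by
    have h1 : 3 * Real.log n ≤ ε ^ 2 / 16 * L := by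
      calc 3 * Real.log n = ε ^ 2 / 16 * (48 / ε * Real.log n / ε) := by field_simp; norm_num
        _ ≤ _ := by gcongr
    have h2 : Real.exp (-(ε ^ 2 / 16 * L)) ≤ ((n : ℝ) ^ 3)⁻¹ := by
      calc _ ≤ Real.exp (-(3 * Real.log n)) := Real.exp_le_exp.2 (by linarith)
        _ = _ := by
          rw [Real.exp_neg, mul_comm, Real.exp_mul, Real.exp_log hn0]
          norm_cast
    calc (n : ℝ) ^ 2 * Real.exp (-(ε ^ 2 / 16 * L)) ≤ (n : ℝ) ^ 2 * ((n : ℝ) ^ 3)⁻¹ := by gcongr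
      _ = 1 / (n : ℝ) := by field_simp
      _ ≤ 1 / (m : ℝ) := one_div_le_one_div_of_le hm0 (by nlinarith)
      _ ≤ 48 / ε / m := by
        gcongr
        rw [le_div_iff₀ hε0]
        linarith
  have hsplit := Finset.card_filter_add_card_filter_not
    (s := (Finset.univ : Finset (Fin m → Fin n × (Fin L → ZMod 2))))
    (fun ω => LinearIndependent (ZMod 2) (fun i => blockRow (ZMod 2) n L (ω i)))
  rw [Finset.card_univ] at hsplit
  have hsplit' := congrArg (Nat.cast (R := ℝ)) hsplit
  rw [Nat.cast_add] at hsplit'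
  have : NeZero n := ⟨by omega⟩
  have htot : (0 : ℝ) < Fintype.card (Fin m → Fin n × (Fin L → ZMod 2)) := by
    exact_mod_cast Fintype.card_pos
  rw [le_div_iff₀ htot, sub_mul, one_mul]
  have := mul_le_mul_of_nonneg_right hexp htot.le
  linarith
end

section
/- Let F be any fixed finite field. For every ε ∈ (0,1) there exists a constant C > 0 such that for all sufficiently large n the following holds: with m = ⌈(1−ε)n⌉ and L = ⌈C·(log n)/ε⌉, the m rows of the random block matrix A over F are linearly independent over F with probability at least 1 − C/m. -/
/-- The entry in column `j` of a row that carries the block `p` from column `s` on. -/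
def shiftedBlock {F : Type} [Zero F] {L : ℕ} (s : ℕ) (p : Fin L → F) (j : ℕ) : F :=
  if h : s ≤ j ∧ j < s + L then p ⟨j - s, by omega⟩ else 0

lemma shiftedBlock_eq_zero {F : Type} [Zero F] {L s j : ℕ} (p : Fin L → F)
    (h : ¬ (s ≤ j ∧ j < s + L)) : shiftedBlock s p j = 0 := dif_neg h

lemma shiftedBlock_add {F : Type} [AddMonoid F] {L : ℕ} (s : ℕ) (p p' : Fin L → F) (j : ℕ) :
    shiftedBlock s (p + p') j = shiftedBlock s p j + shiftedBlock s p' j := by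
  unfold shiftedBlock
  split_ifs <;> simp

/-- `x` is a linear dependency between the rows with starting positions `s` and blocks `p`. -/
def IsDependency {F : Type} [Field F] {m n L : ℕ} (s : Fin m → Fin n) (p : Fin m → Fin L → F)
    (x : Fin m → F) : Prop :=
  ∀ j : ℕ, ∑ i, x i * shiftedBlock (s i : ℕ) (p i) j = 0

/-- The rows in the support of `x` start in `{a, …, b}` and together cover all columns from `a`
to `b + L - 1`. -/
def SpansInterval {F : Type} [Field F] {m n : ℕ} (L : ℕ) (s : Fin m → Fin n) (a b : Fin n)
    (x : Fin m → F) : Prop :=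
  (∀ i, x i ≠ 0 → a ≤ s i ∧ s i ≤ b) ∧
    ∀ j : ℕ, (a : ℕ) ≤ j → j < b + L → ∃ i, x i ≠ 0 ∧ (s i : ℕ) ≤ j ∧ j < s i + L

lemma exists_isDependency_of_not_linearIndependent {F : Type} [Field F] {m n L : ℕ}
    (s : Fin m → Fin n) (p : Fin m → Fin L → F)
    (h : ¬ LinearIndependent F (fun i => blockRow F n L (s i, p i))) :
    ∃ x : Fin m → F, x ≠ 0 ∧ IsDependency s p x := by
  obtain ⟨g, hg, i₀, hi₀⟩ := Fintype.not_linearIndependent_iff.1 h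
  refine ⟨g, fun h0 => hi₀ (by simp [h0]), fun j => ?_⟩
  by_cases hj : j < n + L - 1
  · simpa [Finset.sum_apply, blockRow, shiftedBlock] using congrFun hg ⟨j, hj⟩
  · refine Finset.sum_eq_zero fun i _ => ?_
    rw [shiftedBlock_eq_zero _ (by have := (s i).isLt; omega), mul_zero]

lemma IsDependency.restrict {F : Type} [Field F] {m n L : ℕ} {s : Fin m → Fin n}
    {p : Fin m → Fin L → F} {x : Fin m → F} (hx : IsDependency s p x) {c : ℕ}
    (hc : ∀ i, x i ≠ 0 → ¬ ((s i : ℕ) ≤ c ∧ c < s i + L)) :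
    IsDependency s p (fun i => if (s i : ℕ) ≤ c then x i else 0) := by
  intro j
  rcases lt_or_ge j c with hj | hj
  · refine (Finset.sum_congr rfl fun i _ => ?_).trans (hx j)
    dsimp only
    split_ifs with h
    · rfl
    · rw [shiftedBlock_eq_zero _ (by omega), mul_zero, mul_zero]
  · refine Finset.sum_eq_zero fun i _ => ?_
    dsimp only
    split_ifs with h
    · by_cases hi : x i = 0
      · rw [hi, zero_mul]
      · have := hc i hi
        rw [shiftedBlock_eq_zero _ (by omega), mul_zero]
    · rw [zero_mul]

/-- Any linear dependency yields one whose rows cover a contiguous range of columns. -/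
lemma IsDependency.exists_spansInterval {F : Type} [Field F] [Finite F] {m n L : ℕ}
    {s : Fin m → Fin n} {p : Fin m → Fin L → F} {y : Fin m → F} (hy0 : y ≠ 0)
    (hy : IsDependency s p y) :
    ∃ a b : Fin n, a ≤ b ∧ ∃ x, SpansInterval L s a b x ∧ IsDependency s p x := by
  classical
  obtain ⟨x, ⟨hx0, hx⟩, hmin⟩ := Set.exists_min_image
    {x : Fin m → F | x ≠ 0 ∧ IsDependency s p x}
    (fun x => (Finset.univ.filter fun i => x i ≠ 0).card) (Set.toFinite _) ⟨y, hy0, hy⟩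
  obtain ⟨i₀, hi₀⟩ := Function.ne_iff.1 hx0
  have hne : (Finset.univ.filter fun i => x i ≠ 0).Nonempty := ⟨i₀, by simpa using hi₀⟩
  obtain ⟨ia, hia, ha⟩ := Finset.exists_min_image _ s hne
  obtain ⟨ib, hib, hb⟩ := Finset.exists_max_image _ s hne
  simp only [Finset.mem_filter, Finset.mem_univ, true_and] at hia hib ha hb
  refine ⟨s ia, s ib, ha ib hib, x, ⟨fun i hi => ⟨ha i hi, hb i hi⟩, fun c hac hcb => ?_⟩, hx⟩
  by_contra! hc
  have hc' : ∀ i, x i ≠ 0 → ¬ ((s i : ℕ) ≤ c ∧ c < s i + L) := fun i hi h =>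
    absurd (hc i hi h.1) (by omega)
  have hlt := hmin _ ⟨Function.ne_iff.2 ⟨ia, by simpa [hac] using hia⟩, hx.restrict hc'⟩
  refine absurd hlt (not_le.2 (Finset.card_lt_card ?_))
  refine (Finset.ssubset_iff_of_subset ?_).2 ⟨ib, by simpa using hib, ?_⟩
  · intro i
    simp +contextual
  · have := hc' ib hib
    have h' : ¬ (s ib : ℕ) ≤ c := by omega
    simp [h']

open Classical in
/-- Only a fraction `|F|^(-(b + L - a))` of all blocks turns a vector that spans the interval from
`a` to `b` into a dependency. -/
lemma SpansInterval.card_isDependency_mul_le {F : Type} [Field F] [Fintype F] {m n L : ℕ}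
    {s : Fin m → Fin n} {a b : Fin n} {x : Fin m → F} (hx : SpansInterval L s a b x) :
    (Finset.univ.filter fun p : Fin m → Fin L → F => IsDependency s p x).card *
      Fintype.card F ^ ((b : ℕ) + L - a) ≤ Fintype.card (Fin m → Fin L → F) := by
  let T : (Fin m → Fin L → F) →+ (Fin ((b : ℕ) + L - a) → F) :=
    { toFun := fun p c => ∑ i, x i * shiftedBlock (s i : ℕ) (p i) (a + c)
      map_zero' := by
        ext c
        simp [shiftedBlock]
      map_add' := fun p p' => by
        ext c
        simp [shiftedBlock_add, mul_add, Finset.sum_add_distrib] }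
  have hcov : ∀ c : Fin ((b : ℕ) + L - a),
      ∃ i, x i ≠ 0 ∧ (s i : ℕ) ≤ a + c ∧ (a : ℕ) + c < s i + L :=
    fun c => hx.2 _ (by omega) (by omega)
  choose r hr0 hr1 hr2 using hcov
  have hT : Function.Surjective T := by
    intro y
    refine ⟨fun i k => if h : (a : ℕ) ≤ s i + k ∧ (s i : ℕ) + k - a < b + L - a then
      if r ⟨s i + k - a, h.2⟩ = i then (x i)⁻¹ * y ⟨s i + k - a, h.2⟩ else 0 else 0, ?_⟩
    ext c
    change ∑ i, x i * shiftedBlock (s i : ℕ) _ (a + c) = y c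
    rw [Finset.sum_eq_single (r c)]
    · simp [shiftedBlock, hr1, hr2, hr0]
    · intro i _ hi
      by_cases h : (s i : ℕ) ≤ a + c ∧ (a : ℕ) + c < s i + L
      · simp [shiftedBlock, h, hi.symm]
      · rw [shiftedBlock_eq_zero _ h, mul_zero]
    · simp
  have hcard : Nat.card (Fin m → Fin L → F) =
      Nat.card (Fin ((b : ℕ) + L - a) → F) * Nat.card T.ker := by
    rw [← Nat.card_congr (QuotientAddGroup.quotientKerEquivOfSurjective T hT).toEquiv]
    exact AddSubgroup.card_eq_card_quotient_mul_card_addSubgroup _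
  have hrange : Nat.card (Fin ((b : ℕ) + L - a) → F) = Fintype.card F ^ ((b : ℕ) + L - a) := by
    simp
  rw [Nat.card_eq_fintype_card, hrange] at hcard
  rw [hcard, mul_comm]
  refine Nat.mul_le_mul_left _ ?_
  rw [Nat.card_eq_fintype_card, ← Fintype.card_subtype]
  refine Fintype.card_le_of_injective
    (fun p => (⟨p.1, by ext c; exact p.2 _⟩ : T.ker)) fun p p' h => ?_
  exact Subtype.ext (congrArg (fun z : T.ker => (z : Fin m → Fin L → F)) h)

open Classical in
/-- There are at most `|F|^N` vectors that span the interval from `a` to `b`, where `N` is the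
number of rows that start in it. -/
lemma card_spansInterval_le {F : Type} [Field F] [Fintype F] {m n : ℕ} (L : ℕ)
    (s : Fin m → Fin n) (a b : Fin n) :
    (Finset.univ.filter fun x : Fin m → F => SpansInterval L s a b x).card ≤
      Fintype.card F ^ (Finset.univ.filter fun i => a ≤ s i ∧ s i ≤ b).card := by
  rw [← Fintype.card_subtype (fun i => a ≤ s i ∧ s i ≤ b), ← Fintype.card_fun,
    ← Fintype.card_subtype]
  refine Fintype.card_le_of_injective (fun x i => x.1 i.1) fun x y h => Subtype.ext ?_
  ext i
  by_cases hi : a ≤ s i ∧ s i ≤ b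
  · exact congrFun h ⟨i, hi⟩
  · rw [not_imp_comm.1 (x.2.1 i) hi, not_imp_comm.1 (y.2.1 i) hi]

open Classical in
lemma card_exists_spansInterval_le {F : Type} [Field F] [Fintype F] {m n L : ℕ}
    (s : Fin m → Fin n) {a b : Fin n} (hab : a ≤ b) {u : ℝ} (hu0 : 0 ≤ u)
    (hu : u ≤ Real.log (Fintype.card F)) :
    ((Finset.univ.filter fun p : Fin m → Fin L → F =>
        ∃ x, SpansInterval L s a b x ∧ IsDependency s p x).card : ℝ) ≤
      Fintype.card (Fin m → Fin L → F) *
        (Real.exp (u * (Finset.univ.filter fun i => a ≤ s i ∧ s i ≤ b).card) *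
          Real.exp (-(u * ((b : ℝ) - a + L)))) := by
  set N := (Finset.univ.filter fun i => a ≤ s i ∧ s i ≤ b).card
  set P := Fintype.card (Fin m → Fin L → F)
  set q := Fintype.card F
  have hq : (0 : ℝ) < q := by exact_mod_cast Fintype.card_pos
  have hab' : (a : ℕ) ≤ b := hab
  have hl : (((b : ℕ) + L - a : ℕ) : ℝ) = (b : ℝ) - a + L := by
    rw [Nat.cast_sub (by omega)]
    push_cast
    ring
  rw [← Real.exp_add, ← hl]
  set l := (b : ℕ) + L - a
  rcases le_or_gt l N with h | h
  · have h' : (l : ℝ) ≤ N := by exact_mod_cast h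
    calc _ ≤ (P : ℝ) := by exact_mod_cast Finset.card_le_univ _
      _ ≤ _ := le_mul_of_one_le_right (Nat.cast_nonneg _) (Real.one_le_exp (by nlinarith))
  · have h' : (N : ℝ) ≤ l := by exact_mod_cast h.le
    have hmul : (Finset.univ.filter fun p : Fin m → Fin L → F =>
        ∃ x, SpansInterval L s a b x ∧ IsDependency s p x).card * q ^ l ≤ q ^ N * P := by
      calc _ ≤ (∑ x ∈ Finset.univ.filter fun x : Fin m → F => SpansInterval L s a b x,
            (Finset.univ.filter fun p : Fin m → Fin L → F => IsDependency s p x).card) * q ^ l := by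
            refine Nat.mul_le_mul_right _ (le_trans (Finset.card_le_card ?_) Finset.card_biUnion_le)
            intro p
            simp
        _ ≤ ∑ x ∈ Finset.univ.filter fun x : Fin m → F => SpansInterval L s a b x, P := by
            rw [Finset.sum_mul]
            exact Finset.sum_le_sum fun x hx =>
              (Finset.mem_filter.1 hx).2.card_isDependency_mul_le
        _ ≤ q ^ N * P := by
            rw [Finset.sum_const, smul_eq_mul]
            exact Nat.mul_le_mul_right _ (card_spansInterval_le L s a b)
    have hmul' : ((Finset.univ.filter fun p : Fin m → Fin L → F =>
        ∃ x, SpansInterval L s a b x ∧ IsDependency s p x).card : ℝ) * q ^ l ≤ q ^ N * P := by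
      exact_mod_cast hmul
    have hexp : (q : ℝ) ^ N / q ^ l ≤ Real.exp (u * N + -(u * l)) := by
      rw [← Real.exp_log hq, ← Real.exp_nat_mul, ← Real.exp_nat_mul, ← Real.exp_sub,
        Real.exp_le_exp]
      nlinarith
    calc _ ≤ (q : ℝ) ^ N * P / q ^ l := (le_div_iff₀ (by positivity)).2 hmul'
      _ = P * ((q : ℝ) ^ N / q ^ l) := by ring
      _ ≤ _ := by gcongr

open Classical in
/-- The moment generating function of the number of uniformly random starting positions that fall
into an interval. -/
lemma sum_exp_card_Icc_le {m n : ℕ} (hn : 0 < n) {a b : Fin n} (hab : a ≤ b) (u : ℝ)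
    (hu0 : 0 ≤ u) :
    ∑ s : Fin m → Fin n, Real.exp (u * (Finset.univ.filter fun i => a ≤ s i ∧ s i ≤ b).card) ≤
      (n : ℝ) ^ m * Real.exp (m * (((b : ℝ) - a + 1) * (Real.exp u - 1) / n)) := by
  have hn' : (0 : ℝ) < n := by exact_mod_cast hn
  have hab' : (a : ℕ) ≤ b := hab
  have hprod : ∀ s : Fin m → Fin n,
      Real.exp (u * (Finset.univ.filter fun i => a ≤ s i ∧ s i ≤ b).card) =
        ∏ i, (1 + if a ≤ s i ∧ s i ≤ b then Real.exp u - 1 else 0) := fun s => by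
    rw [mul_comm, Real.exp_nat_mul, ← Finset.prod_const, Finset.prod_filter]
    refine Finset.prod_congr rfl fun i _ => ?_
    split_ifs <;> simp
  have hsum : ∑ v : Fin n, (1 + if a ≤ v ∧ v ≤ b then Real.exp u - 1 else 0) =
      n * (((b : ℝ) - a + 1) * (Real.exp u - 1) / n + 1) := by
    have hIcc : (Finset.univ.filter fun v : Fin n => a ≤ v ∧ v ≤ b) = Finset.Icc a b := by
      ext v
      simp
    rw [Finset.sum_add_distrib, ← Finset.sum_filter, hIcc, Finset.sum_const, Finset.sum_const,
      Fin.card_Icc, Finset.card_univ, Fintype.card_fin, nsmul_eq_mul, nsmul_eq_mul,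
      Nat.cast_sub (by omega)]
    push_cast
    field_simp
    ring
  rw [Finset.sum_congr rfl fun s _ => hprod s,
    ← Fintype.sum_pow (fun v : Fin n => 1 + if a ≤ v ∧ v ≤ b then Real.exp u - 1 else 0), hsum,
    mul_pow, Real.exp_nat_mul]
  have : (0 : ℝ) ≤ ((b : ℝ) - a + 1) * (Real.exp u - 1) / n := by
    have h1 : (a : ℝ) ≤ b := by exact_mod_cast hab'
    have h2 := Real.add_one_le_exp u
    have h3 : 0 ≤ (b : ℝ) - a + 1 := by linarith
    have h4 : 0 ≤ Real.exp u - 1 := by linarith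
    positivity
  gcongr
  exact Real.add_one_le_exp _

lemma chernoff_exponent_le {ε m n k L : ℝ} (hε0 : 0 < ε) (hε1 : ε < 1) (hn : 0 < n)
    (hm : m ≤ (1 - ε) * n + 1) (hk0 : 0 ≤ k) (hkn : k + 1 ≤ n) (hL : 1 ≤ L) :
    m * ((k + 1) * (Real.exp (ε / 2) - 1) / n) - ε / 2 * (k + L) ≤ 1 - ε ^ 2 * L / 4 := by
  have he : Real.exp (ε / 2) - 1 ≤ ε / 2 + (ε / 2) ^ 2 := by
    have := (abs_le.1 (Real.abs_exp_sub_one_sub_id_le (x := ε / 2)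
      (abs_le.2 ⟨by linarith, by linarith⟩))).2
    linarith
  have he0 : 0 ≤ Real.exp (ε / 2) - 1 := by linarith [Real.add_one_le_exp (ε / 2)]
  have hmk : m * ((k + 1) / n) ≤ (1 - ε) * (k + L) + 1 := by
    calc m * ((k + 1) / n) ≤ ((1 - ε) * n + 1) * ((k + 1) / n) := by gcongr
      _ = (1 - ε) * (k + 1) + (k + 1) / n := by field_simp
      _ ≤ (1 - ε) * (k + L) + 1 := by
        have h1 : (k + 1) / n ≤ 1 := (div_le_one hn).2 hkn
        nlinarith
  have hpos : 0 ≤ (1 - ε) * (k + L) + 1 := by nlinarith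
  calc m * ((k + 1) * (Real.exp (ε / 2) - 1) / n) - ε / 2 * (k + L)
      = m * ((k + 1) / n) * (Real.exp (ε / 2) - 1) - ε / 2 * (k + L) := by ring
    _ ≤ ((1 - ε) * (k + L) + 1) * (ε / 2 + (ε / 2) ^ 2) - ε / 2 * (k + L) := by gcongr
    _ = ε / 2 + (ε / 2) ^ 2 - ε ^ 2 / 4 * (k + L) - ε ^ 3 / 4 * (k + L) := by ring
    _ ≤ 1 - ε ^ 2 * L / 4 := by
      have h1 : 0 ≤ ε ^ 3 / 4 * (k + L) := by positivity
      have h2 : 0 ≤ ε ^ 2 / 4 * k := by positivity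
      nlinarith

open Classical in
lemma card_not_linearIndependent_le {F : Type} [Field F] [Fintype F] {m n L : ℕ} {ε : ℝ}
    (hε0 : 0 < ε) (hε1 : ε < 1) (hn : 0 < n) (hm : (m : ℝ) ≤ (1 - ε) * n + 1) (hL : 1 ≤ L) :
    ((Finset.univ.filter fun ω : Fin m → Fin n × (Fin L → F) =>
        ¬ LinearIndependent F fun i => blockRow F n L (ω i)).card : ℝ) ≤
      n ^ 2 * Real.exp (1 - ε ^ 2 * L / 4) *
        Fintype.card (Fin m → Fin n × (Fin L → F)) := by
  set P := Fintype.card (Fin m → Fin L → F)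
  have hq : ε / 2 ≤ Real.log (Fintype.card F) := by
    have h2 : (2 : ℝ) ≤ Fintype.card F := by exact_mod_cast Fintype.one_lt_card
    have := Real.log_le_log (by norm_num) h2
    linarith [Real.log_two_gt_d9]
  have hcard : Fintype.card (Fin m → Fin n × (Fin L → F)) = n ^ m * P := by
    rw [Fintype.card_congr (Equiv.arrowProdEquivProdArrow (Fin m) _ _), Fintype.card_prod,
      Fintype.card_fun, Fintype.card_fin, Fintype.card_fin]
  let E : Fin n × Fin n → (Fin m → Fin n) → Finset (Fin m → Fin L → F) := fun c s =>
    Finset.univ.filter fun p => ∃ x, SpansInterval L s c.1 c.2 x ∧ IsDependency s p x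
  let I : Finset (Fin n × Fin n) := Finset.univ.filter fun c => c.1 ≤ c.2
  have hunion : (Finset.univ.filter fun ω : Fin m → Fin n × (Fin L → F) =>
      ¬ LinearIndependent F fun i => blockRow F n L (ω i)).card ≤
        ∑ c ∈ I, ∑ s : Fin m → Fin n, (E c s).card := by
    calc _ ≤ (I.biUnion fun c => Finset.univ.sigma (E c)).card := by
          refine Finset.card_le_card_of_injOn
            (fun ω => ⟨fun i => (ω i).1, fun i => (ω i).2⟩) (fun ω hω => ?_) ?_
          · obtain ⟨y, hy0, hy⟩ := exists_isDependency_of_not_linearIndependent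
              (fun i => (ω i).1) (fun i => (ω i).2) (by simpa using hω)
            obtain ⟨a, b, hab, hx⟩ := hy.exists_spansInterval hy0
            simp only [Finset.coe_biUnion, Set.mem_iUnion]
            exact ⟨(a, b), by simpa [I] using hab, by simpa [E] using hx⟩
          · intro ω _ ω' _ h
            simp only [Sigma.mk.injEq, heq_eq_eq] at h
            exact funext fun i => Prod.ext (congrFun h.1 i) (congrFun h.2 i)
      _ ≤ _ := Finset.card_biUnion_le.trans (by simp)
  have hinterval : ∀ c ∈ I, ∑ s : Fin m → Fin n, ((E c s).card : ℝ) ≤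
      (n : ℝ) ^ m * P * Real.exp (1 - ε ^ 2 * L / 4) := by
    rintro ⟨a, b⟩ hc
    have hab : a ≤ b := by simpa [I] using hc
    have hab' : (a : ℝ) ≤ b := by exact_mod_cast hab
    have hbn : (b : ℝ) + 1 ≤ n := by exact_mod_cast b.isLt
    have ha0 : (0 : ℝ) ≤ a := Nat.cast_nonneg _
    calc _ ≤ ∑ s : Fin m → Fin n, P *
          (Real.exp (ε / 2 * (Finset.univ.filter fun i => a ≤ s i ∧ s i ≤ b).card) *
            Real.exp (-(ε / 2 * ((b : ℝ) - a + L)))) :=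
          Finset.sum_le_sum fun s _ => card_exists_spansInterval_le s hab (by positivity) hq
      _ = P * ((∑ s : Fin m → Fin n,
          Real.exp (ε / 2 * (Finset.univ.filter fun i => a ≤ s i ∧ s i ≤ b).card)) *
            Real.exp (-(ε / 2 * ((b : ℝ) - a + L)))) := by
          rw [← Finset.mul_sum, ← Finset.sum_mul]
      _ ≤ P * ((n : ℝ) ^ m *
          Real.exp (m * (((b : ℝ) - a + 1) * (Real.exp (ε / 2) - 1) / n)) *
            Real.exp (-(ε / 2 * ((b : ℝ) - a + L)))) := by
          gcongr
          exact sum_exp_card_Icc_le hn hab _ (by positivity)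
      _ = (n : ℝ) ^ m * P * Real.exp (m * (((b : ℝ) - a + 1) * (Real.exp (ε / 2) - 1) / n) -
            ε / 2 * ((b : ℝ) - a + L)) := by
          rw [sub_eq_add_neg _ (ε / 2 * _), Real.exp_add]
          ring
      _ ≤ _ := by
          refine mul_le_mul_of_nonneg_left (Real.exp_le_exp.2 ?_) (by positivity)
          exact chernoff_exponent_le hε0 hε1 (Nat.cast_pos.2 hn) hm (sub_nonneg.2 hab')
            (by linarith) (Nat.one_le_cast.2 hL)
  have hI : (I.card : ℝ) ≤ n ^ 2 := by
    have : I.card ≤ n ^ 2 := I.card_le_univ.trans (by simp [sq])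
    exact_mod_cast this
  calc _ ≤ ∑ c ∈ I, ∑ s : Fin m → Fin n, ((E c s).card : ℝ) := by exact_mod_cast hunion
    _ ≤ ∑ c ∈ I, (n : ℝ) ^ m * P * Real.exp (1 - ε ^ 2 * L / 4) := Finset.sum_le_sum hinterval
    _ = I.card * ((n : ℝ) ^ m * P * Real.exp (1 - ε ^ 2 * L / 4)) := by
        rw [Finset.sum_const, nsmul_eq_mul]
    _ ≤ n ^ 2 * ((n : ℝ) ^ m * P * Real.exp (1 - ε ^ 2 * L / 4)) := by gcongr
    _ = _ := by
        rw [hcard]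
        push_cast
        ring

open Classical in
/-- Let `F` be any fixed finite field.  For every `ε ∈ (0,1)` there is a constant
`C > 0` such that for all sufficiently large `n`, with `m = ⌈(1-ε)n⌉` and
`L = ⌈C (log n)/ε⌉`, the `m` rows of the random block matrix over `F` (one uniformly
random starting position in `{1,…,n}` and one uniformly random block of `L` field
elements per row, all rows independent) are linearly independent over `F` with
probability at least `1 - C/m`. -/
theorem fullRowRank_of_randomBlockMatrix_finiteField
    (F : Type) [Field F] [Fintype F] (ε : ℝ) (hε0 : 0 < ε) (hε1 : ε < 1) :
    ∃ C : ℝ, 0 < C ∧ ∃ N : ℕ, ∀ n : ℕ, N ≤ n →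
      (1 : ℝ) - C / (⌈(1 - ε) * (n : ℝ)⌉₊ : ℝ) ≤
        ((Finset.univ.filter
            (fun ω : Fin ⌈(1 - ε) * (n : ℝ)⌉₊ →
                Fin n × (Fin ⌈C * Real.log n / ε⌉₊ → F) =>
              LinearIndependent F
                (fun i => blockRow F n ⌈C * Real.log n / ε⌉₊ (ω i)))).card : ℝ) /
        (Fintype.card (Fin ⌈(1 - ε) * (n : ℝ)⌉₊ →
            Fin n × (Fin ⌈C * Real.log n / ε⌉₊ → F)) : ℝ) := by
  refine ⟨12 / ε, by positivity, 2, fun n hn => ?_⟩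
  have hn2 : (2 : ℝ) ≤ n := by exact_mod_cast hn
  have hlog : 0 < Real.log n := Real.log_pos (by linarith)
  have hmn : 0 < (1 - ε) * (n : ℝ) := mul_pos (by linarith) (by linarith)
  have hm0 : 0 < ⌈(1 - ε) * (n : ℝ)⌉₊ := Nat.ceil_pos.2 hmn
  have hm1 : (⌈(1 - ε) * (n : ℝ)⌉₊ : ℝ) ≤ (1 - ε) * n + 1 := (Nat.ceil_lt_add_one hmn.le).le
  have hm2 : ⌈(1 - ε) * (n : ℝ)⌉₊ ≤ n := Nat.ceil_le.2 (by nlinarith)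
  have hL0 : 0 < ⌈12 / ε * Real.log n / ε⌉₊ := Nat.ceil_pos.2 (by positivity)
  have hL1 : 12 / ε * Real.log n / ε ≤ (⌈12 / ε * Real.log n / ε⌉₊ : ℝ) := Nat.le_ceil _
  generalize ⌈(1 - ε) * (n : ℝ)⌉₊ = m at *
  generalize ⌈12 / ε * Real.log n / ε⌉₊ = L at *
  have : NeZero n := ⟨by omega⟩
  have hbad := card_not_linearIndependent_le (F := F) hε0 hε1 (by omega : 0 < n) hm1 hL0
  have hsplit := Finset.card_filter_add_card_filter_not (s := Finset.univ)
    fun ω : Fin m → Fin n × (Fin L → F) => LinearIndependent F fun i => blockRow F n L (ω i)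
  rw [Finset.card_univ] at hsplit
  have hsplit' := congrArg (Nat.cast : ℕ → ℝ) hsplit
  rw [Nat.cast_add] at hsplit'
  have hcard : (0 : ℝ) < Fintype.card (Fin m → Fin n × (Fin L → F)) := by
    exact_mod_cast Fintype.card_pos
  have hexp : (n : ℝ) ^ 2 * Real.exp (1 - ε ^ 2 * L / 4) ≤ 12 / ε / m := by
    have hn0 : (0 : ℝ) < n := by linarith
    have hm0' : (0 : ℝ) < m := by exact_mod_cast hm0
    have h3 : 3 * Real.log n ≤ ε ^ 2 * L / 4 := by
      have : ε ^ 2 * (12 / ε * Real.log n / ε) / 4 = 3 * Real.log n := by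
        field_simp
        norm_num
      rw [← this]
      gcongr
    calc (n : ℝ) ^ 2 * Real.exp (1 - ε ^ 2 * L / 4)
        ≤ (n : ℝ) ^ 2 * Real.exp (1 - 3 * Real.log n) := by gcongr
      _ = Real.exp 1 / n := by
        rw [Real.exp_sub, mul_comm 3, Real.exp_mul, Real.exp_log hn0]
        norm_cast
        field_simp
        push_cast
        ring
      _ ≤ 12 / ε / m := by
        have h12 : 12 ≤ 12 / ε := (le_div_iff₀ hε0).2 (by linarith)
        have he : Real.exp 1 ≤ 12 / ε := by linarith [Real.exp_one_lt_d9]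
        gcongr
  rw [le_div_iff₀ hcard]
  nlinarith [mul_le_mul_of_nonneg_right hexp hcard.le]
end

section
/- For every ε ∈ (0,1) there exists a constant C > 0 such that for all sufficiently large n the following holds: with m = ⌈(1−ε)n⌉ and L = ⌈C·(log n)/ε⌉, with probability at least 1 − C/m the random block matrix A is such that for every right-hand side b ∈ 𝔽₂^m there exists a vector z ∈ 𝔽₂^{n+L−1} with A·z = b (i.e. the linear map z ↦ A·z is surjective onto 𝔽₂^m). -/
/-- The rows indexed by `T` sum to zero, all start in `[a, b]`, and together their blocks cover
every column of `[a, b + L)`. -/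
def IsCoveringDependency {m n L : ℕ} (s : Fin m → Fin n) (p : Fin m → Fin L → ZMod 2)
    (a b : Fin n) (T : Finset (Fin m)) : Prop :=
  a ≤ b ∧ (∀ i ∈ T, s i ∈ Finset.Icc a b) ∧
    (∀ t : ℕ, a.val ≤ t → t < b.val + L → ∃ i ∈ T, (s i).val ≤ t ∧ t < (s i).val + L) ∧
    ∑ i ∈ T, blockRow (ZMod 2) n L (s i, p i) = 0

/-- A nonempty dependency of minimal size is a covering dependency: an uncovered column would
split it into two smaller ones. -/
theorem exists_isCoveringDependency {m n L : ℕ} (s : Fin m → Fin n) (p : Fin m → Fin L → ZMod 2)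
    (S : Finset (Fin m)) (hS : S.Nonempty)
    (hsum : ∑ i ∈ S, blockRow (ZMod 2) n L (s i, p i) = 0) :
    ∃ a b T, IsCoveringDependency s p a b T := by
  induction hk : S.card using Nat.strong_induction_on generalizing S with
  | _ k ih =>
    obtain ⟨ia, hia, hamin⟩ := S.exists_min_image s hS
    obtain ⟨ib, hib, hbmax⟩ := S.exists_max_image s hS
    by_cases hcov : ∀ t : ℕ, (s ia).val ≤ t → t < (s ib).val + L →
        ∃ i ∈ S, (s i).val ≤ t ∧ t < (s i).val + L
    · exact ⟨s ia, s ib, S, hamin ib hib,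
        fun i hi => Finset.mem_Icc.2 ⟨hamin i hi, hbmax i hi⟩, hcov, hsum⟩
    · push Not at hcov
      obtain ⟨t, hat, htb, hun⟩ := hcov
      have hlt : (S.filter fun i => (s i).val ≤ t).card < k := by
        rw [← hk]
        refine Finset.card_lt_card (Finset.filter_ssubset.2 ⟨ib, hib, fun h => ?_⟩)
        have := hun ib hib h
        omega
      refine ih _ hlt _ ⟨ia, by simp [hia, hat]⟩ ?_ rfl
      funext j
      have hj := congrFun hsum j
      simp only [Finset.sum_apply, Pi.zero_apply] at hj ⊢
      rcases lt_or_ge j.val t with hjt | hjt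
      · rw [← hj]
        refine Finset.sum_subset (Finset.filter_subset _ _) fun i hi hi' => ?_
        have : t < (s i).val := by
          by_contra! h
          exact hi' (Finset.mem_filter.2 ⟨hi, h⟩)
        exact dif_neg fun h => by have := h.1; simp only at this; omega
      · refine Finset.sum_eq_zero fun i hi => ?_
        obtain ⟨hi, hit⟩ := Finset.mem_filter.1 hi
        have := hun i hi hit
        exact dif_neg fun h => by have := h.2; simp only at this; omega

theorem exists_isCoveringDependency_of_not_surjective {m n L : ℕ}
    (ω : Fin m → Fin n × (Fin L → ZMod 2))
    (h : ¬ ∀ b : Fin m → ZMod 2, ∃ z : Fin (n + L - 1) → ZMod 2,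
      Matrix.mulVec (Matrix.of (fun i => blockRow (ZMod 2) n L (ω i))) z = b) :
    ∃ a b T, IsCoveringDependency (fun i => (ω i).1) (fun i => (ω i).2) a b T := by
  set A : Matrix (Fin m) (Fin (n + L - 1)) (ZMod 2) :=
    Matrix.of (fun i => blockRow (ZMod 2) n L (ω i)) with hA
  have hdep : ¬ LinearIndependent (ZMod 2) A.row := by
    intro hli
    have hrank := hli.rank_matrix
    have htop : LinearMap.range A.mulVecLin = ⊤ := by
      apply Submodule.eq_top_of_finrank_eq
      rw [← Matrix.rank, hrank]
      simp
    exact h fun b => LinearMap.range_eq_top.1 htop b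
  obtain ⟨g, hg, i₀, hi₀⟩ := Fintype.not_linearIndependent_iff.1 hdep
  refine exists_isCoveringDependency _ _ (Finset.univ.filter fun i => g i ≠ 0)
    ⟨i₀, by simpa using hi₀⟩ ?_
  refine Eq.trans ?_ hg
  rw [Finset.sum_filter]
  refine Finset.sum_congr rfl fun i _ => ?_
  have h01 : ∀ x : ZMod 2, x = 0 ∨ x = 1 := by decide
  rcases h01 (g i) with h | h
  · simp [h]
  · simp only [h, ne_eq, one_ne_zero, not_false_eq_true, if_true, one_smul]
    rfl

open Classical in
/-- The blocks making a covering family `T` dependent have density at most `2 ^ -(b - a + L)`. -/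
theorem card_isCoveringDependency_mul_le {m n L : ℕ} (s : Fin m → Fin n) (a b : Fin n)
    (T : Finset (Fin m)) :
    (Finset.univ.filter fun p : Fin m → Fin L → ZMod 2 =>
      IsCoveringDependency s p a b T).card * 2 ^ (b.val - a.val + L) ≤ 2 ^ (m * L) := by
  rcases (Finset.univ.filter fun p : Fin m → Fin L → ZMod 2 =>
      IsCoveringDependency s p a b T).eq_empty_or_nonempty with he | ⟨p₀, hp₀⟩
  · simp [he]
  obtain ⟨hab, -, hcov, -⟩ := (Finset.mem_filter.1 hp₀).2
  have hab' : a.val ≤ b.val := hab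
  rcases Nat.eq_zero_or_pos (b.val - a.val + L) with hl | hl
  · rw [hl, pow_zero, mul_one]
    refine (Finset.card_le_univ _).trans ?_
    simp [← pow_mul, mul_comm L m]
  have : Nonempty (Fin m) := by
    obtain ⟨i, -⟩ := hcov a.val le_rfl (by omega)
    exact ⟨i⟩
  choose! c hcT hc1 hc2 using hcov
  let g : (Fin (b.val - a.val + L) → ZMod 2) → Fin m → Fin L → ZMod 2 := fun v i k =>
    if h : a.val ≤ (s i).val + k.val ∧ (s i).val + k.val < b.val + L ∧
        c ((s i).val + k.val) = i then
      v ⟨(s i).val + k.val - a.val, by omega⟩ else 0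
  have hg : ∀ v (t : Fin (b.val - a.val + L)) (ht : a.val + t.val < n + L - 1),
      ∑ i ∈ T, blockRow (ZMod 2) n L (s i, g v i) ⟨a.val + t.val, ht⟩ = v t := by
    intro v t ht
    have h0 := t.isLt
    have h1 := hc1 (a.val + t.val) (by omega) (by omega)
    have h2 := hc2 (a.val + t.val) (by omega) (by omega)
    have h3 := hcT (a.val + t.val) (by omega) (by omega)
    rw [Finset.sum_eq_single_of_mem (c (a.val + t.val)) h3]
    · have e : (s (c (a.val + t.val))).val + (a.val + t.val - (s (c (a.val + t.val))).val)
          = a.val + t.val := by omega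
      simp only [blockRow, h1, h2, and_self, dif_pos, g]
      rw [dif_pos]
      · congr 1
        ext
        simp only
        omega
      · simp only [e, and_true]
        omega
    · intro i _ hi
      simp only [blockRow, g]
      split_ifs with h h'
      · exfalso
        have e : (s i).val + (a.val + t.val - (s i).val) = a.val + t.val := by omega
        rw [e] at h'
        exact hi h'.2.2.symm
      · rfl
      · rfl
  have hadd : ∀ (p q : Fin m → Fin L → ZMod 2) (i : Fin m) (j : Fin (n + L - 1)),
      blockRow (ZMod 2) n L (s i, p i + q i) j =
        blockRow (ZMod 2) n L (s i, p i) j + blockRow (ZMod 2) n L (s i, q i) j := by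
    intro p q i j
    simp only [blockRow]
    split_ifs <;> simp
  have hinj : Set.InjOn (fun x : (Fin m → Fin L → ZMod 2) ×
      (Fin (b.val - a.val + L) → ZMod 2) => x.1 + g x.2)
      ↑((Finset.univ.filter fun p : Fin m → Fin L → ZMod 2 =>
        IsCoveringDependency s p a b T) ×ˢ
        (Finset.univ : Finset (Fin (b.val - a.val + L) → ZMod 2))) := by
    rintro ⟨p, v⟩ hp ⟨q, w⟩ hq h
    simp only [Finset.coe_product, Set.mem_prod, Finset.mem_coe, Finset.mem_filter,
      Finset.mem_univ, true_and, and_true] at hp hq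
    have key : ∀ (p : Fin m → Fin L → ZMod 2) v, IsCoveringDependency s p a b T →
        ∀ (t : Fin (b.val - a.val + L)) (ht : a.val + t.val < n + L - 1),
        ∑ i ∈ T, blockRow (ZMod 2) n L (s i, (p + g v) i) ⟨a.val + t.val, ht⟩ = v t := by
      intro p v hp t ht
      have h0 := congrFun hp.2.2.2 ⟨a.val + t.val, ht⟩
      simp only [Finset.sum_apply, Pi.zero_apply] at h0
      simp only [Pi.add_apply p, hadd, Finset.sum_add_distrib, h0, hg, zero_add]
    have hvw : v = w := by
      funext t
      have ht : a.val + t.val < n + L - 1 := by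
        have := t.isLt
        have := b.isLt
        omega
      rw [← key p v hp t ht, ← key q w hq t ht]
      simp only at h
      rw [h]
    subst hvw
    simpa using h
  have hle := Finset.card_le_card_of_injOn _ (fun _ _ => Finset.mem_univ _) hinj
  simpa [Finset.card_product, ← pow_mul, mul_comm L m] using hle

open Classical in
theorem card_exists_isCoveringDependency_mul_le {m n L : ℕ} (s : Fin m → Fin n) (a b : Fin n)
    {q : ℝ} (hq1 : 1 ≤ q) (hq2 : q ≤ 2) :
    ((Finset.univ.filter fun p : Fin m → Fin L → ZMod 2 =>
      ∃ T, IsCoveringDependency s p a b T).card : ℝ) * q ^ (b.val - a.val + L) ≤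
      2 ^ (m * L) * q ^ (Finset.univ.filter fun i => s i ∈ Finset.Icc a b).card := by
  set R := Finset.univ.filter fun i => s i ∈ Finset.Icc a b
  set B := Finset.univ.filter fun p : Fin m → Fin L → ZMod 2 =>
    ∃ T, IsCoveringDependency s p a b T
  set l := b.val - a.val + L
  rcases le_total l R.card with hl | hl
  · have hB : (B.card : ℝ) ≤ 2 ^ (m * L) := by
      have h := Finset.card_le_univ B
      have h' : B.card ≤ 2 ^ (m * L) := by simpa [← pow_mul, mul_comm L m] using h
      exact_mod_cast h'
    gcongr
  · have hB : B.card * 2 ^ l ≤ 2 ^ R.card * 2 ^ (m * L) := by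
      have hsub : B ⊆ R.powerset.biUnion fun T =>
          Finset.univ.filter fun p : Fin m → Fin L → ZMod 2 =>
            IsCoveringDependency s p a b T := by
        intro p hp
        obtain ⟨T, hT⟩ := (Finset.mem_filter.1 hp).2
        refine Finset.mem_biUnion.2 ⟨T, Finset.mem_powerset.2 fun i hi => ?_, by simpa using hT⟩
        simpa [R] using hT.2.1 i hi
      calc B.card * 2 ^ l
          ≤ (∑ T ∈ R.powerset, (Finset.univ.filter fun p : Fin m → Fin L → ZMod 2 =>
              IsCoveringDependency s p a b T).card) * 2 ^ l :=
            Nat.mul_le_mul_right _ ((Finset.card_le_card hsub).trans Finset.card_biUnion_le)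
        _ ≤ ∑ T ∈ R.powerset, 2 ^ (m * L) := by
            rw [Finset.sum_mul]
            exact Finset.sum_le_sum fun T _ => card_isCoveringDependency_mul_le s a b T
        _ = 2 ^ R.card * 2 ^ (m * L) := by simp [Finset.card_powerset]
    have hB' : (B.card : ℝ) * 2 ^ l ≤ 2 ^ R.card * 2 ^ (m * L) := by exact_mod_cast hB
    obtain ⟨d, hd⟩ := Nat.exists_eq_add_of_le hl
    rw [hd, pow_add] at hB' ⊢
    have hBd : (B.card : ℝ) * 2 ^ d ≤ 2 ^ (m * L) := by
      have h2 : (0 : ℝ) < 2 ^ R.card := by positivity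
      nlinarith
    have hqd : (B.card : ℝ) * q ^ d ≤ 2 ^ (m * L) := le_trans (by gcongr) hBd
    calc (B.card : ℝ) * (q ^ R.card * q ^ d) = (B.card * q ^ d) * q ^ R.card := by ring
      _ ≤ _ := by gcongr

open Classical in
/-- The exponential moment of the number of rows starting in `I`. -/
theorem sum_pow_card_filter_mem {m n : ℕ} (I : Finset (Fin n)) (q : ℝ) :
    ∑ s : Fin m → Fin n, q ^ (Finset.univ.filter fun i => s i ∈ I).card =
      (n + (q - 1) * I.card) ^ m := by
  have h1 : ∀ s : Fin m → Fin n, q ^ (Finset.univ.filter fun i => s i ∈ I).card =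
      ∏ i, if s i ∈ I then q else 1 := by
    intro s
    rw [Finset.prod_ite]
    simp
  have h2 : ∑ x : Fin n, (if x ∈ I then q else 1) = n + (q - 1) * I.card := by
    have : ∀ x : Fin n, (if x ∈ I then q else 1) = 1 + if x ∈ I then q - 1 else 0 := by
      intro x
      split_ifs <;> ring
    simp only [this, Finset.sum_add_distrib, Finset.sum_ite_mem]
    simp
    ring
  simp only [h1]
  rw [← h2, Finset.sum_pow', ← Fintype.piFinset_univ]

open Classical in
theorem sum_card_exists_isCoveringDependency_mul_le {m n L : ℕ} (a b : Fin n)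
    {q : ℝ} (hq1 : 1 ≤ q) (hq2 : q ≤ 2) (hq : (m : ℝ) / n * (q - 1) ≤ Real.log q) :
    (∑ s : Fin m → Fin n, ((Finset.univ.filter fun p : Fin m → Fin L → ZMod 2 =>
      ∃ T, IsCoveringDependency s p a b T).card : ℝ)) * q ^ L ≤
      q * (2 ^ (m * L) * n ^ m) := by
  have hq0 : 0 < q := by linarith
  have hn : (0 : ℝ) < n := by exact_mod_cast a.pos
  by_cases hab : a ≤ b
  swap
  · have : ∀ (s : Fin m → Fin n) (p : Fin m → Fin L → ZMod 2) T,
        ¬ IsCoveringDependency s p a b T := fun s p T h => hab h.1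
    simp only [this, exists_false, Finset.filter_false, Finset.card_empty, Nat.cast_zero,
      Finset.sum_const_zero, zero_mul]
    positivity
  have hab' : a.val ≤ b.val := hab
  have hI : (Finset.Icc a b).card = b.val - a.val + 1 := by
    rw [Fin.card_Icc]
    omega
  set d := b.val - a.val with hd
  have hmom : ((n : ℝ) + (q - 1) * (Finset.Icc a b).card) ^ m ≤ n ^ m * q ^ (d + 1) := by
    have hstep : (n : ℝ) + (q - 1) * (Finset.Icc a b).card ≤
        n * Real.exp ((q - 1) * (d + 1) / n) := by
      have h := Real.add_one_le_exp ((q - 1) * (d + 1) / n)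
      calc (n : ℝ) + (q - 1) * (Finset.Icc a b).card
          = n * ((q - 1) * (d + 1) / n + 1) := by
            rw [hI]
            push_cast
            field_simp
            ring
        _ ≤ _ := by gcongr
    calc ((n : ℝ) + (q - 1) * (Finset.Icc a b).card) ^ m
        ≤ (n * Real.exp ((q - 1) * (d + 1) / n)) ^ m := by
          refine pow_le_pow_left₀ ?_ hstep m
          have : 0 ≤ q - 1 := by linarith
          positivity
      _ = n ^ m * Real.exp ((m : ℝ) / n * (q - 1) * (d + 1)) := by
          rw [mul_pow, ← Real.exp_nat_mul]
          congr 2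
          ring
      _ ≤ n ^ m * Real.exp (Real.log q * (d + 1)) := by gcongr
      _ = n ^ m * q ^ (d + 1) := by
          rw [mul_comm (Real.log q)]
          have := Real.exp_nat_mul (Real.log q) (d + 1)
          push_cast at this
          rw [this, Real.exp_log hq0]
  have hsum : (∑ s : Fin m → Fin n, ((Finset.univ.filter fun p : Fin m → Fin L → ZMod 2 =>
      ∃ T, IsCoveringDependency s p a b T).card : ℝ)) * q ^ (d + L) ≤
      2 ^ (m * L) * (n ^ m * q ^ (d + 1)) := by
    calc _ ≤ ∑ s : Fin m → Fin n,
          2 ^ (m * L) * q ^ (Finset.univ.filter fun i => s i ∈ Finset.Icc a b).card := by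
          rw [Finset.sum_mul]
          exact Finset.sum_le_sum fun s _ =>
            card_exists_isCoveringDependency_mul_le s a b hq1 hq2
      _ = 2 ^ (m * L) * (n + (q - 1) * (Finset.Icc a b).card) ^ m := by
          rw [← Finset.mul_sum, sum_pow_card_filter_mem]
      _ ≤ _ := by gcongr
  rw [pow_add, pow_succ] at hsum
  refine le_of_mul_le_mul_right ?_ (pow_pos hq0 d)
  linarith

open Classical in
theorem card_not_surjective_mul_le {m n L : ℕ}
    {q : ℝ} (hq1 : 1 ≤ q) (hq2 : q ≤ 2) (hq : (m : ℝ) / n * (q - 1) ≤ Real.log q) :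
    ((Finset.univ.filter fun ω : Fin m → Fin n × (Fin L → ZMod 2) =>
      ¬ ∀ b : Fin m → ZMod 2, ∃ z : Fin (n + L - 1) → ZMod 2,
        Matrix.mulVec (Matrix.of (fun i => blockRow (ZMod 2) n L (ω i))) z = b).card : ℝ) *
      q ^ L ≤ n ^ 2 * (q * Fintype.card (Fin m → Fin n × (Fin L → ZMod 2))) := by
  set B := Finset.univ.filter fun ω : Fin m → Fin n × (Fin L → ZMod 2) =>
      ¬ ∀ b : Fin m → ZMod 2, ∃ z : Fin (n + L - 1) → ZMod 2,
        Matrix.mulVec (Matrix.of (fun i => blockRow (ZMod 2) n L (ω i))) z = b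
  let E : Fin n × Fin n → Finset (Fin m → Fin n × (Fin L → ZMod 2)) := fun x =>
    Finset.univ.filter fun ω =>
      ∃ T, IsCoveringDependency (fun i => (ω i).1) (fun i => (ω i).2) x.1 x.2 T
  have hE : ∀ x, (E x).card = ∑ s : Fin m → Fin n,
      (Finset.univ.filter fun p : Fin m → Fin L → ZMod 2 =>
        ∃ T, IsCoveringDependency s p x.1 x.2 T).card := by
    intro x
    simp only [E, Finset.card_filter]
    rw [← Fintype.sum_prod_type']
    exact Fintype.sum_equiv (Equiv.arrowProdEquivProdArrow _ _ _) _ _ fun ω => rfl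
  have hsub : B ⊆ Finset.univ.biUnion E := by
    intro ω hω
    obtain ⟨a, b, T, hT⟩ :=
      exists_isCoveringDependency_of_not_surjective ω (Finset.mem_filter.1 hω).2
    exact Finset.mem_biUnion.2 ⟨(a, b), Finset.mem_univ _,
      Finset.mem_filter.2 ⟨Finset.mem_univ _, T, hT⟩⟩
  have hB : (B.card : ℝ) ≤ ∑ x, ((E x).card : ℝ) := by
    exact_mod_cast (Finset.card_le_card hsub).trans Finset.card_biUnion_le
  have hcard : (Fintype.card (Fin m → Fin n × (Fin L → ZMod 2)) : ℝ) = 2 ^ (m * L) * n ^ m := by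
    simp [mul_pow, ← pow_mul, mul_comm]
  calc (B.card : ℝ) * q ^ L ≤ (∑ x, ((E x).card : ℝ)) * q ^ L := by gcongr
    _ = ∑ x, ((E x).card : ℝ) * q ^ L := Finset.sum_mul ..
    _ ≤ ∑ x : Fin n × Fin n, q * (2 ^ (m * L) * n ^ m) := by
        refine Finset.sum_le_sum fun x _ => ?_
        rw [hE x]
        push_cast
        exact sum_card_exists_isCoveringDependency_mul_le x.1 x.2 hq1 hq2 hq
    _ = _ := by
        rw [hcard]
        simp [sq]

open Classical in
/-- For every `ε ∈ (0,1)` there is a constant `C > 0` such that for all sufficiently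
large `n`, with `m = ⌈(1-ε)n⌉` and `L = ⌈C (log n)/ε⌉`, with probability at least
`1 - C/m` the random block matrix `A` is such that for every right-hand side
`b ∈ 𝔽₂^m` there is a `z ∈ 𝔽₂^{n+L-1}` with `A ⬝ z = b`, i.e. `z ↦ A ⬝ z` is
surjective onto `𝔽₂^m`. -/
theorem randomBlockMatrix_surjective (ε : ℝ) (hε0 : 0 < ε) (hε1 : ε < 1) :
    ∃ C : ℝ, 0 < C ∧ ∃ N : ℕ, ∀ n : ℕ, N ≤ n →
      (1 : ℝ) - C / (⌈(1 - ε) * (n : ℝ)⌉₊ : ℝ) ≤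
        ((Finset.univ.filter
            (fun ω : Fin ⌈(1 - ε) * (n : ℝ)⌉₊ →
                Fin n × (Fin ⌈C * Real.log n / ε⌉₊ → ZMod 2) =>
              ∀ b : Fin ⌈(1 - ε) * (n : ℝ)⌉₊ → ZMod 2,
                ∃ z : Fin (n + ⌈C * Real.log n / ε⌉₊ - 1) → ZMod 2,
                  Matrix.mulVec
                    (Matrix.of (fun i => blockRow (ZMod 2) n ⌈C * Real.log n / ε⌉₊ (ω i)))
                    z = b)).card : ℝ) /
        (Fintype.card (Fin ⌈(1 - ε) * (n : ℝ)⌉₊ →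
            Fin n × (Fin ⌈C * Real.log n / ε⌉₊ → ZMod 2)) : ℝ) := by
  classical
  refine ⟨9, by norm_num, ⌈2 / ε⌉₊, fun n hn => ?_⟩
  have hn' : 2 / ε ≤ n := (Nat.le_ceil _).trans (by exact_mod_cast hn)
  have hεn : 2 ≤ ε * n := by
    rw [div_le_iff₀ hε0] at hn'
    linarith
  have hn0 : (0 : ℝ) < n := by nlinarith
  have hm1 := Nat.ceil_lt_add_one (show 0 ≤ (1 - ε) * (n : ℝ) by nlinarith)
  have hm0 : 0 < ⌈(1 - ε) * (n : ℝ)⌉₊ := Nat.ceil_pos.2 (by nlinarith)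
  have hL := Nat.le_ceil (9 * Real.log n / ε)
  generalize ⌈(1 - ε) * (n : ℝ)⌉₊ = m at *
  generalize ⌈9 * Real.log n / ε⌉₊ = L at *
  have hm0' : (0 : ℝ) < m := by exact_mod_cast hm0
  have hlog : 1 - (1 + ε / 2)⁻¹ ≤ Real.log (1 + ε / 2) :=
    Real.one_sub_inv_le_log_of_pos (by positivity)
  have hinv : 1 - (1 + ε / 2)⁻¹ = (ε / 2) / (1 + ε / 2) := by
    field_simp
    ring
  have hq : (m : ℝ) / n * (1 + ε / 2 - 1) ≤ Real.log (1 + ε / 2) := by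
    have hmn : (m : ℝ) / n ≤ 1 - ε / 2 := by
      rw [div_le_iff₀ hn0]
      linarith
    refine le_trans ?_ (hinv ▸ hlog)
    rw [le_div_iff₀ (by positivity)]
    calc (m : ℝ) / n * (1 + ε / 2 - 1) * (1 + ε / 2)
        ≤ (1 - ε / 2) * (1 + ε / 2 - 1) * (1 + ε / 2) := by
          have : 0 ≤ 1 + ε / 2 - 1 := by linarith
          gcongr
      _ ≤ ε / 2 := by nlinarith [pow_pos hε0 3]
  have hqL : (n : ℝ) ^ 3 ≤ (1 + ε / 2) ^ L := by
    have hε3 : ε / 3 ≤ Real.log (1 + ε / 2) := by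
      refine le_trans ?_ (hinv ▸ hlog)
      rw [le_div_iff₀ (by positivity)]
      nlinarith
    rw [← Real.log_le_log_iff (by positivity) (by positivity), Real.log_pow, Real.log_pow]
    rw [div_le_iff₀ hε0] at hL
    push_cast
    nlinarith [mul_le_mul_of_nonneg_left hε3 (Nat.cast_nonneg (α := ℝ) L)]
  have hbad := card_not_surjective_mul_le (L := L)
    (show 1 ≤ 1 + ε / 2 by linarith) (by linarith) hq
  have hsplit := Finset.card_filter_add_card_filter_not
    (s := (Finset.univ : Finset (Fin m → Fin n × (Fin L → ZMod 2))))
    (fun ω => ∀ b : Fin m → ZMod 2, ∃ z : Fin (n + L - 1) → ZMod 2,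
        Matrix.mulVec (Matrix.of (fun i => blockRow (ZMod 2) n L (ω i))) z = b)
  rw [Finset.card_univ] at hsplit
  have hn1 : 0 < n := by exact_mod_cast hn0
  have : Nonempty (Fin n) := ⟨⟨0, hn1⟩⟩
  have hΩ : (0 : ℝ) < Fintype.card (Fin m → Fin n × (Fin L → ZMod 2)) := by
    exact_mod_cast Fintype.card_pos
  have hsplit' := congrArg (Nat.cast : ℕ → ℝ) hsplit
  push_cast only [Nat.cast_add] at hsplit'
  generalize (Fintype.card (Fin m → Fin n × (Fin L → ZMod 2)) : ℝ) = M at *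
  generalize hY : ((Finset.univ.filter fun ω : Fin m → Fin n × (Fin L → ZMod 2) =>
      ¬ ∀ b : Fin m → ZMod 2, ∃ z : Fin (n + L - 1) → ZMod 2,
        Matrix.mulVec (Matrix.of (fun i => blockRow (ZMod 2) n L (ω i))) z = b).card : ℝ) = Y at *
  have hY0 : 0 ≤ Y := hY ▸ Nat.cast_nonneg _
  have hYn : Y * n ≤ 2 * M := by
    have h1 : Y * n ^ 3 ≤ n ^ 2 * ((1 + ε / 2) * M) :=
      (mul_le_mul_of_nonneg_left hqL hY0).trans hbad
    have h2 : Y * n ≤ (1 + ε / 2) * M := by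
      refine le_of_mul_le_mul_left ?_ (pow_pos hn0 2)
      linarith
    nlinarith
  have hYm : Y * m ≤ 9 * M := by
    have : (m : ℝ) ≤ n := by nlinarith
    nlinarith
  rw [le_div_iff₀ hΩ, ← hsplit', sub_mul, one_mul, hsplit']
  have : Y ≤ 9 / m * M := by
    rw [div_mul_eq_mul_div, le_div_iff₀ hm0']
    exact hYm
  linarith
end

section
/- Let c be a nonnegative integer, let (k_j)_{j≥1} and (b'_j)_{j≥1} be sequences of nonnegative integers, and let (g_j)_{j≥1} be a sequence of positive integers such that for every j ≥ 1, g_j > c implies b'_j ≥ 1. Let (H_j)_{j≥0} be the height sequence associated with (k_j) and (g_j), and define X_0 = 0 and X_j = max(0, X_{j−1} + k_j + b'_j − 1) for j ≥ 1. Then H_j ≤ X_j + c for every j ≥ 0. -/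
/-- The height sequence of coin-flipping Robin Hood hashing: given arrival counts
`(k_j)_{j≥1}` and coin-flip counts `(g_j)_{j≥1}`, we set `H_0 = 0` and, for `j ≥ 1`,
`H_j = H_{j-1} + k_j - 1` if `g_j ≤ H_{j-1} + k_j`, and `H_j = H_{j-1} + k_j`
otherwise. -/
def heightSeq (k g : ℕ → ℕ) : ℕ → ℕ
  | 0 => 0
  | j + 1 =>
    if g (j + 1) ≤ heightSeq k g j + k (j + 1) then heightSeq k g j + k (j + 1) - 1
    else heightSeq k g j + k (j + 1)

/-- Let `c ≥ 0`, let `(k_j)_{j≥1}` and `(b'_j)_{j≥1}` be nonnegative integers, and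
let `(g_j)_{j≥1}` be positive integers such that `g_j > c` implies `b'_j ≥ 1`.
Let `(H_j)` be the height sequence for `(k_j)` and `(g_j)`, and define `X_0 = 0`,
`X_j = max(0, X_{j-1} + k_j + b'_j - 1)` for `j ≥ 1`.  Then `H_j ≤ X_j + c` for all
`j ≥ 0`. -/
theorem heightSeq_le_X_add_const (c : ℕ) (k b' g : ℕ → ℕ)
    (hg : ∀ j : ℕ, 1 ≤ g j) (hb : ∀ j : ℕ, c < g j → 1 ≤ b' j)
    (X : ℕ → ℤ) (hX0 : X 0 = 0)
    (hX : ∀ j : ℕ, 1 ≤ j → X j = max 0 (X (j - 1) + (k j : ℤ) + (b' j : ℤ) - 1)) :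
    ∀ j : ℕ, (heightSeq k g j : ℤ) ≤ X j + (c : ℤ) := by
  intro j
  induction j with
  | zero => simp [heightSeq, hX0]
  | succ n ih =>
    have hX' := hX (n + 1) (by omega)
    have hg' := hg (n + 1)
    have hb' := hb (n + 1)
    rw [Nat.add_sub_cancel] at hX'
    rw [heightSeq]
    split_ifs <;> omega
end

section
/- Let ε' ∈ (0,1] and let c be a nonnegative integer satisfying 2^{−c} ≤ 1 − e^{−ε'/2} (in particular c = log₂(4/ε') works whenever this is an integer). Then there exists a probability space carrying two random variables g and b' such that g has the Geom(1/2) distribution, b' has the Poisson(ε'/2) distribution, and almost surely g > c implies b' ≥ 1. -/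
open scoped ENNReal

namespace PMF

variable {α β : Type*}

/-- If `q b₀ • u ≤ p`, then `p` is a mixture, with weights `q`, of `u` (at `b₀`) and a single
other distribution (away from `b₀`). -/
theorem exists_bind_ite_eq [DecidableEq β] (p u : PMF α) (q : PMF β) (b₀ : β)
    (hq : q b₀ ≠ 1) (hu : ∀ a, q b₀ * u a ≤ p a) :
    ∃ r : PMF α, q.bind (fun b => if b = b₀ then u else r) = p := by
  have hlt : q b₀ < 1 := lt_of_le_of_ne (q.coe_le_one b₀) hq
  have h0 : 1 - q b₀ ≠ 0 := (tsub_pos_of_lt hlt).ne'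
  have htop : 1 - q b₀ ≠ ∞ := ENNReal.sub_ne_top ENNReal.one_ne_top
  have hsum : ∑' a, (p a - q b₀ * u a) = 1 - q b₀ := by
    refine ENNReal.eq_sub_of_add_eq (q.apply_ne_top b₀) ?_
    calc ∑' a, (p a - q b₀ * u a) + q b₀
        = ∑' a, (p a - q b₀ * u a) + ∑' a, q b₀ * u a := by
          rw [ENNReal.tsum_mul_left, u.tsum_coe, mul_one]
      _ = ∑' a, p a := by
          rw [← ENNReal.tsum_add]
          exact tsum_congr fun a => tsub_add_cancel_of_le (hu a)
      _ = 1 := p.tsum_coe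
  have hsplit (f : β → ℝ≥0∞) : ∑' b, f b = f b₀ + ∑' b, if b = b₀ then 0 else f b := by
    convert ENNReal.tsum_eq_add_tsum_ite b₀
  have hrest : ∑' b, (if b = b₀ then 0 else q b) = 1 - q b₀ := by
    have h := hsplit q
    rw [q.tsum_coe] at h
    rw [h, ENNReal.add_sub_cancel_left (q.apply_ne_top b₀)]
  refine ⟨⟨fun a => (p a - q b₀ * u a) * (1 - q b₀)⁻¹, ?_⟩, ?_⟩
  · rw [ENNReal.summable.hasSum_iff, ENNReal.tsum_mul_right, hsum, ENNReal.mul_inv_cancel h0 htop]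
  · ext a
    set r : PMF α := ⟨fun a => (p a - q b₀ * u a) * (1 - q b₀)⁻¹, _⟩
    have hr : r a = (p a - q b₀ * u a) * (1 - q b₀)⁻¹ := rfl
    have hite : ∀ b, (if b = b₀ then 0 else q b * (if b = b₀ then u else r) a)
        = (if b = b₀ then 0 else q b) * r a := by
      intro b
      split_ifs <;> simp
    rw [bind_apply, hsplit, if_pos rfl]
    simp_rw [hite]
    rw [ENNReal.tsum_mul_right, hrest, hr, mul_comm (1 - q b₀), mul_assoc,
      ENNReal.inv_mul_cancel h0 htop, mul_one, add_tsub_cancel_of_le (hu a)]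

/-- If the atom `b₀` of `q` has at most the mass that `p` gives to `s`, then `p` and `q` have a
coupling in which the second coordinate is `b₀` only when the first one lies in `s`. -/
theorem exists_coupling_mem_of_eq (p : PMF α) (q : PMF β) (s : Set α) (b₀ : β)
    (hs : ∃ a ∈ s, a ∈ p.support) (hq : q b₀ ≠ 1) (hle : q b₀ ≤ ∑' a, s.indicator p a) :
    ∃ μ : PMF (α × β), μ.map Prod.fst = p ∧ μ.map Prod.snd = q ∧
      ∀ x ∈ μ.support, x.2 = b₀ → x.1 ∈ s := by
  classical
  have hu : ∀ a, q b₀ * p.filter s hs a ≤ p a := by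
    intro a
    rw [filter_apply, mul_left_comm, ← div_eq_mul_inv]
    calc s.indicator p a * (q b₀ / ∑' a, s.indicator p a)
        ≤ p a * 1 := by
          gcongr
          · exact Set.indicator_le_self s p a
          · exact ENNReal.div_le_of_le_mul (by simpa using hle)
      _ = p a := mul_one _
  obtain ⟨r, hr⟩ := exists_bind_ite_eq p (p.filter s hs) q b₀ hq hu
  refine ⟨q.bind fun b => (if b = b₀ then p.filter s hs else r).map (·, b), ?_, ?_, ?_⟩
  · simp_rw [map_bind, map_comp]
    exact (congrArg q.bind (funext fun b => map_id _)).trans hr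
  · simp_rw [map_bind, map_comp]
    exact (congrArg q.bind (funext fun b => map_const _ b)).trans q.bind_pure
  · rintro ⟨a, b⟩ hx rfl
    simp only [mem_support_bind_iff, mem_support_map_iff, Prod.mk.injEq] at hx
    obtain ⟨b', -, a', ha', rfl, rfl⟩ := hx
    rw [if_pos rfl, mem_support_filter_iff] at ha'
    exact ha'.1

end PMF

theorem hasSum_geom_half :
    HasSum (fun a : ℕ => if a = 0 then 0 else ((2 : ℝ≥0∞)⁻¹) ^ a) 1 := by
  rw [ENNReal.summable.hasSum_iff, tsum_eq_zero_add' ENNReal.summable]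
  simp [ENNReal.tsum_geometric_add_one, ENNReal.one_sub_inv_two,
    ENNReal.inv_mul_cancel]

theorem sum_geom_half_add (c : ℕ) :
    ∑ a ∈ Finset.range (c + 1), (if a = 0 then 0 else ((2 : ℝ≥0∞)⁻¹) ^ a) + 2⁻¹ ^ c = 1 := by
  induction c with
  | zero => simp
  | succ c ih =>
    rw [Finset.sum_range_succ, if_neg c.succ_ne_zero, add_assoc, pow_succ, ← mul_add,
      ENNReal.inv_two_add_inv_two, mul_one, ih]

theorem hasSum_poisson {l : ℝ} (hl : 0 ≤ l) :
    HasSum (fun a : ℕ => ENNReal.ofReal (Real.exp (-l) * l ^ a / (Nat.factorial a))) 1 := by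
  have h : HasSum (fun a : ℕ => Real.exp (-l) * l ^ a / (Nat.factorial a)) 1 :=
    ProbabilityTheory.hasSum_one_poissonMeasure ⟨l, hl⟩
  rw [ENNReal.summable.hasSum_iff, ← ENNReal.ofReal_tsum_of_nonneg _ h.summable]
  · rw [h.tsum_eq, ENNReal.ofReal_one]
  · intro a
    positivity



/-- Let `ε' ∈ (0,1]` and let `c ≥ 0` be an integer with `2^{-c} ≤ 1 - e^{-ε'/2}`.
Then there is a (discrete) probability space — a joint probability mass function
`μ` on `ℕ × ℕ` — whose first coordinate `g` is `Geom(1/2)`-distributed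
(`P(g = k) = 2^{-k}` for `k ≥ 1`), whose second coordinate `b'` is
`Poisson(ε'/2)`-distributed, and such that almost surely (on the support of `μ`)
`g > c` implies `b' ≥ 1`. -/
theorem exists_coupling_geom_poisson (ε' : ℝ) (hε0 : 0 < ε') (hε1 : ε' ≤ 1)
    (c : ℕ) (hc : ((2 : ℝ)⁻¹) ^ c ≤ 1 - Real.exp (-(ε' / 2))) :
    ∃ μ : PMF (ℕ × ℕ),
      (∀ a : ℕ, μ.map Prod.fst a = if a = 0 then 0 else ((2 : ℝ≥0∞)⁻¹) ^ a) ∧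
      (∀ a : ℕ, μ.map Prod.snd a =
        ENNReal.ofReal (Real.exp (-(ε' / 2)) * (ε' / 2) ^ a / (Nat.factorial a))) ∧
      (∀ p ∈ μ.support, c < p.1 → 1 ≤ p.2) := by
  have hlt : Real.exp (-(ε' / 2)) < 1 := Real.exp_lt_one_iff.mpr (by linarith)
  have hc0 : c ≠ 0 := by
    rintro rfl
    linarith [Real.exp_pos (-(ε' / 2)), pow_zero (2 : ℝ)⁻¹]
  let p : PMF ℕ := ⟨_, hasSum_geom_half⟩
  let q : PMF ℕ := ⟨_, hasSum_poisson (half_pos hε0).le⟩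
  have hp : ∀ a, p a = if a = 0 then 0 else ((2 : ℝ≥0∞)⁻¹) ^ a := fun _ => rfl
  have hq0 : q 0 = ENNReal.ofReal (Real.exp (-(ε' / 2))) := by
    change ENNReal.ofReal _ = _
    simp
  have hmass : ∑' a, (Set.Iic c).indicator p a
      = ∑ a ∈ Finset.range (c + 1), (if a = 0 then 0 else ((2 : ℝ≥0∞)⁻¹) ^ a) := by
    rw [tsum_eq_sum (s := Finset.range (c + 1))]
    · refine Finset.sum_congr rfl fun a ha => ?_
      rw [Set.indicator_of_mem (by simpa [Nat.lt_succ_iff] using ha), hp]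
    · intro a ha
      exact Set.indicator_of_notMem (by simpa [Nat.lt_succ_iff] using ha) _
  obtain ⟨μ, h₁, h₂, h₃⟩ := p.exists_coupling_mem_of_eq q (Set.Iic c) 0
    ⟨1, Nat.one_le_iff_ne_zero.mpr hc0, by simp [PMF.mem_support_iff, hp]⟩
    (by rw [hq0]; exact (ENNReal.ofReal_lt_one.mpr hlt).ne) (by
      have hpow : ((2 : ℝ≥0∞)⁻¹) ^ c = ENNReal.ofReal ((2 : ℝ)⁻¹ ^ c) := by
        rw [ENNReal.ofReal_pow (by norm_num), ENNReal.ofReal_inv_of_pos two_pos,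
          ENNReal.ofReal_ofNat]
      have hfin : ((2 : ℝ≥0∞)⁻¹) ^ c ≠ ∞ := hpow ▸ ENNReal.ofReal_ne_top
      rw [hmass, hq0, ← ENNReal.add_le_add_iff_right hfin, sum_geom_half_add, hpow,
        ← ENNReal.ofReal_add (Real.exp_pos _).le (by positivity)]
      exact ENNReal.ofReal_le_one.mpr (by linarith))
  refine ⟨μ, fun a => by rw [h₁, hp], fun a => by rw [h₂]; rfl, fun x hx hcx => ?_⟩
  exact Nat.one_le_iff_ne_zero.mpr fun h => (h₃ x hx h).not_gt hcx
end

section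
/- Fix ρ ∈ (0,1) and consider the Markov transition kernel K on the nonnegative integers defined by: from state 0 the next state is distributed as d, and from state z > 0 the next state is distributed as z + d − 1, where d has the Poisson(ρ) distribution. Then K admits a stationary probability distribution π on the nonnegative integers (i.e. π transported through K equals π), and the mean of π equals Σ_{k≥0} k·π(k) = ρ + ρ²/(2(1−ρ)). -/
open scoped ENNReal

namespace PowerSeries

/-- The sum of the coefficients of `F`, weighted by `φ`. -/
noncomputable def weightedSum (φ : ℕ → ℝ≥0∞) (F : PowerSeries ℝ≥0∞) : ℝ≥0∞ :=
  ∑' n, φ n * coeff n F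

lemma tsum_tsum_eq_tsum_antidiagonal (h : ℕ → ℕ → ℝ≥0∞) :
    ∑' a, ∑' b, h a b = ∑' n, ∑ x ∈ Finset.HasAntidiagonal.antidiagonal n, h x.1 x.2 := by
  rw [← ENNReal.tsum_prod, ← Finset.HasAntidiagonal.sigmaAntidiagonalEquivProd.tsum_eq,
    ENNReal.tsum_sigma']
  refine tsum_congr fun n => ?_
  rw [tsum_fintype, Finset.univ_eq_attach]
  exact Finset.sum_attach (Finset.HasAntidiagonal.antidiagonal n) fun x => h x.1 x.2

lemma weightedSum_mul (φ : ℕ → ℝ≥0∞) (F G : PowerSeries ℝ≥0∞) :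
    weightedSum φ (F * G) = ∑' a, ∑' b, φ (a + b) * (coeff a F * coeff b G) := by
  rw [tsum_tsum_eq_tsum_antidiagonal, weightedSum]
  refine tsum_congr fun n => ?_
  rw [coeff_mul, Finset.mul_sum]
  refine Finset.sum_congr rfl fun x hx => ?_
  rw [Finset.HasAntidiagonal.mem_antidiagonal.1 hx]

/-- The sum of all the coefficients. -/
noncomputable def total : PowerSeries ℝ≥0∞ → ℝ≥0∞ := weightedSum fun _ => 1

/-- The first moment of the coefficient sequence. -/
noncomputable def firstMoment : PowerSeries ℝ≥0∞ → ℝ≥0∞ := weightedSum fun n => n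

lemma total_eq (F : PowerSeries ℝ≥0∞) : total F = ∑' n, coeff n F := by
  simp [total, weightedSum]

lemma total_mul (F G : PowerSeries ℝ≥0∞) : total (F * G) = total F * total G := by
  rw [total, weightedSum_mul]
  simp [weightedSum, ENNReal.tsum_mul_left, ENNReal.tsum_mul_right]

lemma firstMoment_mul (F G : PowerSeries ℝ≥0∞) :
    firstMoment (F * G) = firstMoment F * total G + total F * firstMoment G := by
  have h (a b : ℕ) : ((a + b : ℕ) : ℝ≥0∞) * (coeff a F * coeff b G) =
      a * coeff a F * coeff b G + coeff a F * (b * coeff b G) := by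
    push_cast; ring
  rw [firstMoment, weightedSum_mul]
  simp only [h, ENNReal.tsum_add, ENNReal.tsum_mul_left, ENNReal.tsum_mul_right, weightedSum,
    total, one_mul]

lemma weightedSum_one (φ : ℕ → ℝ≥0∞) : weightedSum φ 1 = φ 0 := by
  rw [weightedSum, tsum_eq_single 0 fun n hn => by simp [coeff_one, hn]]
  simp

lemma total_one : total 1 = 1 := weightedSum_one _

lemma firstMoment_one : firstMoment 1 = 0 := by
  simp [firstMoment, weightedSum_one]

lemma weightedSum_C_mul (φ : ℕ → ℝ≥0∞) (c : ℝ≥0∞) (F : PowerSeries ℝ≥0∞) :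
    weightedSum φ (C c * F) = c * weightedSum φ F := by
  simp only [weightedSum, coeff_C_mul, ← ENNReal.tsum_mul_left]
  exact tsum_congr fun n => by ring

lemma total_pow (F : PowerSeries ℝ≥0∞) (m : ℕ) : total (F ^ m) = total F ^ m := by
  induction m with
  | zero => simp [total_one]
  | succ m ih => rw [pow_succ, pow_succ, total_mul, ih]

lemma firstMoment_pow_succ (F : PowerSeries ℝ≥0∞) (m : ℕ) :
    firstMoment (F ^ (m + 1)) = firstMoment F * ((m + 1) * total F ^ m) := by
  induction m with
  | zero => simp
  | succ m ih =>
    rw [pow_succ, firstMoment_mul, ih, total_pow]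
    push_cast
    ring

/-- The sum of all the powers of `F`, coefficient by coefficient. -/
noncomputable def geomSeries (F : PowerSeries ℝ≥0∞) : PowerSeries ℝ≥0∞ :=
  mk fun n => ∑' m, coeff n (F ^ m)

lemma geomSeries_eq (F : PowerSeries ℝ≥0∞) : geomSeries F = 1 + F * geomSeries F := by
  ext n
  simp only [geomSeries, map_add, coeff_mul, coeff_mk, ← ENNReal.tsum_mul_left]
  rw [tsum_eq_zero_add' ENNReal.summable, pow_zero,
    ← Summable.tsum_finsetSum fun _ _ => ENNReal.summable]
  simp only [pow_succ', coeff_mul]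

lemma weightedSum_geomSeries (φ : ℕ → ℝ≥0∞) (F : PowerSeries ℝ≥0∞) :
    weightedSum φ (geomSeries F) = ∑' m, weightedSum φ (F ^ m) := by
  simp only [weightedSum, geomSeries, coeff_mk, ← ENNReal.tsum_mul_left]
  exact ENNReal.tsum_comm

lemma total_geomSeries (F : PowerSeries ℝ≥0∞) : total (geomSeries F) = (1 - total F)⁻¹ := by
  rw [← ENNReal.tsum_geometric, total, weightedSum_geomSeries]
  exact tsum_congr fun m => total_pow F m

lemma tsum_succ_mul_geometric (r : ℝ≥0∞) :
    ∑' m : ℕ, ((m : ℝ≥0∞) + 1) * r ^ m = (1 - r)⁻¹ ^ 2 := by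
  have h := tsum_tsum_eq_tsum_antidiagonal fun a b => r ^ a * r ^ b
  simp only [ENNReal.tsum_mul_left, ENNReal.tsum_mul_right, ENNReal.tsum_geometric] at h
  rw [sq, h]
  refine tsum_congr fun n => ?_
  rw [Finset.sum_congr rfl (g := fun _ => r ^ n) fun x hx => by
    rw [← pow_add, Finset.HasAntidiagonal.mem_antidiagonal.1 hx]]
  simp

lemma firstMoment_geomSeries (F : PowerSeries ℝ≥0∞) :
    firstMoment (geomSeries F) = firstMoment F * (1 - total F)⁻¹ ^ 2 := by
  rw [firstMoment, weightedSum_geomSeries, tsum_eq_zero_add' ENNReal.summable, pow_zero]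
  change firstMoment 1 + ∑' m, firstMoment (F ^ (m + 1)) = firstMoment F * _
  simp only [firstMoment_one, zero_add, firstMoment_pow_succ, ENNReal.tsum_mul_left,
    tsum_succ_mul_geometric]

/-- The generating function of the tails `k ↦ ∑ j > k, f j`. -/
noncomputable def tailSeries (f : ℕ → ℝ≥0∞) : PowerSeries ℝ≥0∞ :=
  mk fun k => ∑' j, f (k + j + 1)

lemma tailSeries_eq (f : ℕ → ℝ≥0∞) :
    C (∑' n, f n) + X * tailSeries f = mk f + tailSeries f := by
  ext (_ | n)
  · simp only [map_add, coeff_zero_C, coeff_zero_X_mul, coeff_mk, tailSeries, add_zero, zero_add]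
    exact tsum_eq_zero_add' ENNReal.summable
  · simp only [map_add, coeff_succ_X_mul, coeff_mk, tailSeries, coeff_C, Nat.succ_ne_zero,
      if_false, zero_add]
    rw [tsum_eq_zero_add' ENNReal.summable]
    congr 1
    exact tsum_congr fun j => congrArg f (by ring)

lemma total_tailSeries (f : ℕ → ℝ≥0∞) :
    total (tailSeries f) = ∑' n : ℕ, ((n : ℝ≥0∞) + 1) * f (n + 1) := by
  simp only [total_eq, tailSeries, coeff_mk]
  rw [tsum_tsum_eq_tsum_antidiagonal fun a b => f (a + b + 1)]
  refine tsum_congr fun n => ?_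
  rw [Finset.sum_congr rfl (g := fun _ => f (n + 1)) fun x hx => by
    rw [Finset.HasAntidiagonal.mem_antidiagonal.1 hx]]
  simp

lemma two_mul_firstMoment_tailSeries (f : ℕ → ℝ≥0∞) :
    2 * firstMoment (tailSeries f) =
      ∑' n : ℕ, ((n : ℝ≥0∞) + 1) * ((n + 2) * f (n + 2)) := by
  simp only [firstMoment, weightedSum, tailSeries, coeff_mk, ← ENNReal.tsum_mul_left]
  rw [tsum_tsum_eq_tsum_antidiagonal fun a b => 2 * ((a : ℝ≥0∞) * f (a + b + 1)),
    tsum_eq_zero_add' ENNReal.summable]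
  simp only [Finset.HasAntidiagonal.antidiagonal_zero, Finset.sum_singleton, Nat.cast_zero,
    zero_mul, mul_zero, zero_add]
  refine tsum_congr fun n => ?_
  have h : (∑ x ∈ Finset.HasAntidiagonal.antidiagonal (n + 1), x.1) * 2 = (n + 2) * (n + 1) := by
    rw [Finset.Nat.sum_antidiagonal_eq_sum_range_succ_mk]
    exact Finset.sum_range_id_mul_two (n + 2)
  have h' : (∑ x ∈ Finset.HasAntidiagonal.antidiagonal (n + 1), (x.1 : ℝ≥0∞)) * 2 =
      (n + 2) * (n + 1) := by
    exact_mod_cast congrArg (Nat.cast : ℕ → ℝ≥0∞) h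
  rw [Finset.sum_congr rfl (g := fun x => (x.1 : ℝ≥0∞) * (2 * f (n + 2))) fun x hx => by
    rw [Finset.HasAntidiagonal.mem_antidiagonal.1 hx]; ring]
  rw [← Finset.sum_mul, ← mul_assoc, h']
  ring

lemma coeff_ne_top_of_total_ne_top {F : PowerSeries ℝ≥0∞} (hF : total F ≠ ∞) (n : ℕ) :
    coeff n F ≠ ∞ :=
  ENNReal.ne_top_of_tsum_ne_top (total_eq F ▸ hF) n

lemma add_right_cancel_of_total_ne_top {F G H : PowerSeries ℝ≥0∞} (hH : total H ≠ ∞)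
    (h : F + H = G + H) : F = G := by
  ext n
  have hn := congrArg (coeff n) h
  rw [map_add, map_add] at hn
  exact (ENNReal.add_left_inj (coeff_ne_top_of_total_ne_top hH n)).1 hn

lemma geomSeries_tailSeries_mul (f : ℕ → ℝ≥0∞) (hf : ∑' n, f n = 1)
    (h : total (tailSeries f) < 1) :
    geomSeries (tailSeries f) * mk f + X = X * geomSeries (tailSeries f) + 1 := by
  have hG := geomSeries_eq (tailSeries f)
  have hE := tailSeries_eq f
  have hfin : total (tailSeries f * geomSeries (tailSeries f)) ≠ ∞ := by
    rw [total_mul, total_geomSeries]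
    exact ENNReal.mul_ne_top h.ne_top (ENNReal.inv_ne_top.2 (tsub_pos_of_lt h).ne')
  rw [hf, map_one] at hE
  refine add_right_cancel_of_total_ne_top hfin ?_
  generalize geomSeries (tailSeries f) = G at *
  generalize tailSeries f = E at *
  calc G * mk f + X + E * G = G * (mk f + E) + X := by ring
    _ = X * (1 + E * G) + G := by rw [← hE]; ring
    _ = X * G + (1 + E * G) := by rw [← hG]
    _ = X * G + 1 + E * G := by ring

end PowerSeries

namespace PMF

open PowerSeries

/-- The one-step transition kernel of a queue in which `d ~ p` customers arrive per step. -/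
noncomputable def queueStep (p : PMF ℕ) (z : ℕ) : PMF ℕ :=
  p.map fun d => if z = 0 then d else z + d - 1

lemma queueStep_zero_apply (p : PMF ℕ) (n : ℕ) : p.queueStep 0 n = p n := by
  have h : (fun d : ℕ => if 0 = 0 then d else 0 + d - 1) = id := by ext; simp
  rw [queueStep, h, PMF.map_id]

lemma queueStep_succ_apply (p : PMF ℕ) (z n : ℕ) :
    p.queueStep (z + 1) n = ∑' d, if n = z + d then p d else 0 := by
  rw [queueStep, PMF.map_apply]
  refine tsum_congr fun d => ?_
  have h : (if z + 1 = 0 then d else z + 1 + d - 1) = z + d := by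
    rw [if_neg z.succ_ne_zero]; lia
  rw [h]
  congr

lemma mk_bind_queueStep (p q : PMF ℕ) :
    (mk fun n => q.bind p.queueStep n) =
      C (q 0) * mk (fun n => p n) + mk (fun n => q (n + 1)) * mk (fun n => p n) := by
  ext n
  have h := weightedSum_mul (fun k => if n = k then 1 else 0)
    (mk fun n => q (n + 1)) (mk fun n => p n)
  rw [weightedSum, tsum_eq_single n fun k hk => by rw [if_neg hk.symm, zero_mul], if_pos rfl,
    one_mul] at h
  rw [map_add, coeff_C_mul, h, coeff_mk, PMF.bind_apply, tsum_eq_zero_add' ENNReal.summable,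
    queueStep_zero_apply]
  simp only [queueStep_succ_apply, ← ENNReal.tsum_mul_left, coeff_mk, ite_mul, mul_ite, one_mul,
    zero_mul, mul_zero]

lemma total_mk (p : PMF ℕ) : total (mk fun n => p n) = 1 := by
  simp only [total_eq, coeff_mk, p.tsum_coe]

lemma bind_queueStep_eq_self (p q : PMF ℕ)
    (h : mk (fun n => q n) * mk (fun n => p n) + X * (C (q 0) * mk (fun n => p n)) =
      X * mk (fun n => q n) + C (q 0) * mk (fun n => p n)) :
    q.bind p.queueStep = q := by
  have hq : mk (fun n => q n) = C (q 0) + X * mk (fun n => q (n + 1)) := by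
    ext (_ | n)
    · simp
    · simp [coeff_succ_X_mul]
  have hfin : total (C (q 0) * mk fun n => p n) ≠ ∞ := by
    rw [total, weightedSum_C_mul]
    change q 0 * total _ ≠ ∞
    rw [total_mk, mul_one]
    exact q.apply_ne_top 0
  have hX : X * mk (fun n => q.bind p.queueStep n) = X * mk (fun n => q n) := by
    refine add_right_cancel_of_total_ne_top hfin ?_
    rw [← h, mk_bind_queueStep]
    rw [hq]
    ring
  ext n
  simpa only [coeff_succ_X_mul, coeff_mk] using congrArg (coeff (n + 1)) hX

/-- The **Pollaczek–Khinchine formula** at the level of generating functions: a queue whose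
arrivals have mean less than one has a stationary law, given by an explicit generating function. -/
lemma exists_bind_queueStep_eq_self (p : PMF ℕ) (h : total (tailSeries fun n => p n) < 1) :
    ∃ q : PMF ℕ, q.bind p.queueStep = q ∧
      mk (fun n => q n) = C (1 - total (tailSeries fun n => p n)) *
        (geomSeries (tailSeries fun n => p n) * mk fun n => p n) := by
  have hG := geomSeries_tailSeries_mul (fun n => p n) p.tsum_coe h
  have hT := total_geomSeries (tailSeries fun n => p n)
  have hc0 := (tsub_pos_of_lt h).ne'
  have hc1 : 1 - total (tailSeries fun n => p n) ≠ ∞ := by finiteness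
  generalize geomSeries (tailSeries fun n => p n) = G at *
  generalize 1 - total (tailSeries fun n => p n) = c at *
  have hsum : ∑' n, coeff n (C c * (G * mk fun n => p n)) = 1 := by
    rw [← total_eq, total, weightedSum_C_mul]
    change c * total _ = 1
    rw [total_mul, total_mk, hT, mul_one, ENNReal.mul_inv_cancel hc0 hc1]
  let q : PMF ℕ := ⟨fun n => coeff n (C c * (G * mk fun n => p n)),
    hsum ▸ ENNReal.summable.hasSum⟩
  have hq : mk (fun n => q n) = C c * (G * mk fun n => p n) := by
    ext n
    exact coeff_mk n _
  have hq0 : q 0 = c := by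
    have h0 := congrArg (coeff 0) hG
    rw [map_add, map_add, coeff_zero_X, coeff_zero_X_mul, coeff_zero_one, add_zero, zero_add] at h0
    change coeff 0 (C c * _) = c
    rw [coeff_C_mul, h0, mul_one]
  refine ⟨q, bind_queueStep_eq_self p q ?_, hq⟩
  rw [hq, hq0]
  calc C c * (G * mk fun n => p n) * (mk fun n => p n) + X * (C c * mk fun n => p n)
      = C c * (mk fun n => p n) * (G * (mk fun n => p n) + X) := by ring
    _ = C c * (mk fun n => p n) * (X * G + 1) := by rw [hG]
    _ = C c * (X * G * (mk fun n => p n)) + C c * mk fun n => p n := by ring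
    _ = X * (C c * (G * mk fun n => p n)) + C c * mk fun n => p n := by ring

end PMF

/-- Fix `ρ ∈ (0,1)` and let `p` be the `Poisson(ρ)` distribution on `ℕ`.  Consider
the Markov transition kernel `K` on `ℕ` where, from state `z`, the next state is
distributed as `d` if `z = 0` and as `z + d - 1` if `z > 0`, with `d ~ p` (the
one-step transition of the M/D/1 queue length observed at integer times).  Then `K`
admits a stationary probability distribution `π` (i.e. `π` transported through `K`
equals `π`) whose mean is `ρ + ρ²/(2(1-ρ))`. -/
theorem MD1_stationary_distribution (ρ : ℝ) (hρ0 : 0 < ρ) (hρ1 : ρ < 1)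
    (p : PMF ℕ)
    (hp : ∀ a : ℕ, p a = ENNReal.ofReal (Real.exp (-ρ) * ρ ^ a / (Nat.factorial a))) :
    ∃ π : PMF ℕ,
      π.bind (fun z => p.map (fun d => if z = 0 then d else z + d - 1)) = π ∧
      ∑' a : ℕ, (a : ℝ) * (π a).toReal = ρ + ρ ^ 2 / (2 * (1 - ρ)) := by
  have hstep (n : ℕ) : ((n : ℝ≥0∞) + 1) * p (n + 1) = ENNReal.ofReal ρ * p n := by
    rw [hp, hp, ← ENNReal.ofReal_mul hρ0.le, ← Nat.cast_succ, ← ENNReal.ofReal_natCast,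
      ← ENNReal.ofReal_mul (Nat.cast_nonneg _), Nat.factorial_succ]
    congr 1
    push_cast
    field_simp
    ring
  have hsum : ∑' n : ℕ, ((n : ℝ≥0∞) + 1) * p (n + 1) = ENNReal.ofReal ρ := by
    simp only [hstep, ENNReal.tsum_mul_left, p.tsum_coe, mul_one]
  have hT : PowerSeries.total (PowerSeries.tailSeries fun n => p n) = ENNReal.ofReal ρ := by
    rw [PowerSeries.total_tailSeries, hsum]
  have hM : 2 * PowerSeries.firstMoment (PowerSeries.tailSeries fun n => p n) =
      ENNReal.ofReal ρ * ENNReal.ofReal ρ := by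
    rw [PowerSeries.two_mul_firstMoment_tailSeries]
    nth_rw 2 [← hsum]
    rw [← ENNReal.tsum_mul_left]
    refine tsum_congr fun n => ?_
    have h := hstep (n + 1)
    push_cast at h
    rw [add_assoc, one_add_one_eq_two] at h
    rw [h]
    ring
  have hP : PowerSeries.firstMoment (PowerSeries.mk fun n => p n) = ENNReal.ofReal ρ := by
    rw [← hsum, PowerSeries.firstMoment, PowerSeries.weightedSum,
      tsum_eq_zero_add' ENNReal.summable]
    simp
  obtain ⟨π, hπ, hgen⟩ := p.exists_bind_queueStep_eq_self
    (by rw [hT]; exact ENNReal.ofReal_lt_one.2 hρ1)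
  refine ⟨π, hπ, ?_⟩
  have hmean := congrArg PowerSeries.firstMoment hgen
  rw [PowerSeries.firstMoment, PowerSeries.weightedSum_C_mul] at hmean
  change _ = _ * PowerSeries.firstMoment _ at hmean
  rw [PowerSeries.firstMoment_mul, PowerSeries.firstMoment_geomSeries,
    PowerSeries.total_geomSeries, p.total_mk, hP, hT] at hmean
  simp only [PowerSeries.weightedSum, PowerSeries.coeff_mk] at hmean
  have hM' := congrArg ENNReal.toReal hM
  have hmean' := congrArg ENNReal.toReal hmean
  have hMfin : PowerSeries.firstMoment (PowerSeries.tailSeries fun n => p n) ≠ ∞ := fun htop => by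
    rw [htop, ENNReal.mul_top two_ne_zero] at hM
    exact ENNReal.mul_ne_top ENNReal.ofReal_ne_top ENNReal.ofReal_ne_top hM.symm
  have hc : 1 - ENNReal.ofReal ρ = ENNReal.ofReal (1 - ρ) := by
    rw [ENNReal.ofReal_sub _ hρ0.le, ENNReal.ofReal_one]
  have hpos : 0 < 1 - ρ := sub_pos.2 hρ1
  rw [hc, ← ENNReal.ofReal_inv_of_pos hpos, ENNReal.tsum_toReal_eq fun n =>
    ENNReal.mul_ne_top (ENNReal.natCast_ne_top n) (π.apply_ne_top n), ENNReal.toReal_mul,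
    ENNReal.toReal_add (by finiteness) (by finiteness)] at hmean'
  simp only [ENNReal.toReal_mul, ENNReal.toReal_pow, ENNReal.toReal_natCast, ENNReal.toReal_one,
    ENNReal.toReal_ofReal hρ0.le, ENNReal.toReal_ofReal hpos.le,
    ENNReal.toReal_ofReal (inv_pos.2 hpos).le, ENNReal.toReal_ofNat] at hmean' hM'
  rw [hmean', (by linarith : (PowerSeries.firstMoment
    (PowerSeries.tailSeries fun n => p n)).toReal = ρ * ρ / 2)]
  field_simp
  ring
end
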